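/- arXiv:0811.3848 — 2 statements merged into one kernel-verified Lean document; each statement's English description precedes it below -/
import Mathlib

section
/- Let H be a Hilbert space and A, B ∈ B(H) compact operators. Let A ⊗̂ B denote the continuous linear extension of A ⊗ B to the projective tensor product H ⊗̂_π H. Then for every n ≥ 1, aₙ(A ⊗̂ B) ≤ 6.75 · (s(A) ⊗ s(B))ₙ. -/
open scoped BigOperators

noncomputable section

/-- The space of complex null sequences `c₀`. -/
def c0 : Set (ℕ → ℂ) := {α | Filter.Tendsto α Filter.atTop (nhds 0)}

/-- `rearrSum α n` is the supremum of `∑_{i ∈ F} |α i|` over finite sets `F ⊆ ℕ` with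
`|F| = n`; for a null sequence it equals `α*₁ + ⋯ + α*ₙ` where `α*` is the decreasing
rearrangement of `(|α_n|)`. -/
def rearrSum (α : ℕ → ℂ) (n : ℕ) : ℝ :=
  sSup ((fun F : Finset ℕ => ∑ i ∈ F, ‖α i‖) '' {F | F.card = n})

/-- The decreasing rearrangement of a null sequence, 0-indexed:
`rearr α n = α*_{n+1}`. -/
def rearr (α : ℕ → ℂ) (n : ℕ) : ℝ := rearrSum α (n + 1) - rearrSum α n

/-- A Calkin space: a linear subspace of `c₀` containing every null sequence whose
decreasing rearrangement is dominated termwise by that of one of its members. -/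
def IsCalkinSpace (I : Set (ℕ → ℂ)) : Prop :=
  I ⊆ c0 ∧ (0 : ℕ → ℂ) ∈ I ∧
  (∀ α ∈ I, ∀ β ∈ I, α + β ∈ I) ∧
  (∀ (c : ℂ), ∀ α ∈ I, c • α ∈ I) ∧
  (∀ α ∈ I, ∀ β ∈ c0, (∀ n, rearr β n ≤ rearr α n) → β ∈ I)

/-- `tensorSum α β n` is the supremum of `∑_{(i,j) ∈ F} |α i| |β j|` over finite
`F ⊆ ℕ × ℕ` with `|F| = n`; it equals `(α⊗β)₁ + ⋯ + (α⊗β)ₙ`. -/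
def tensorSum (α β : ℕ → ℂ) (n : ℕ) : ℝ :=
  sSup ((fun F : Finset (ℕ × ℕ) => ∑ p ∈ F, ‖α p.1‖ * ‖β p.2‖) '' {F | F.card = n})

/-- The tensor sequence `α⊗β`: the decreasing rearrangement of the double sequence
`(|α_m β_n|)_{m,n}`, 0-indexed: `tensorSeq α β n = (α⊗β)_{n+1}`. -/
def tensorSeq (α β : ℕ → ℂ) (n : ℕ) : ℝ := tensorSum α β (n + 1) - tensorSum α β n

/-- Embedding of real sequences into complex sequences. -/
def toC (f : ℕ → ℝ) : ℕ → ℂ := fun n => (f n : ℂ)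

/-- The tensor product `𝔦⊗𝔧` of two Calkin spaces: the smallest Calkin space
containing `α⊗β` for all `α ∈ 𝔦`, `β ∈ 𝔧`. -/
def calkinTensor (I J : Set (ℕ → ℂ)) : Set (ℕ → ℂ) :=
  ⋂₀ {K | IsCalkinSpace K ∧ ∀ α ∈ I, ∀ β ∈ J, toC (tensorSeq α β) ∈ K}

/-- A Calkin space `𝔦` is stable if `𝔦⊗𝔦 = 𝔦`. -/
def IsStableCalkin (I : Set (ℕ → ℂ)) : Prop := IsCalkinSpace I ∧ calkinTensor I I = I

/-- The principal Calkin space `⟨α⟩` generated by `α`: the smallest Calkin space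
containing `α`. -/
def principalCalkin (α : ℕ → ℂ) : Set (ℕ → ℂ) := ⋂₀ {K | IsCalkinSpace K ∧ α ∈ K}

/-- `Kw ω α n = #{m : ω^{n+1} < α m ≤ ω^n}` (the sequence `α` being 0-indexed). -/
def Kw (ω : ℝ) (α : ℕ → ℝ) (n : ℕ) : ℕ :=
  Set.ncard {m : ℕ | ω ^ (n + 1) < α m ∧ α m ≤ ω ^ n}

/-- `K̃ₙ = Σ_{i=0}^n Kᵢ`. -/
def Ktil (ω : ℝ) (α : ℕ → ℝ) (n : ℕ) : ℕ := ∑ i ∈ Finset.range (n + 1), Kw ω α i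

/-- `Mₙ = Σ_{i+j=n} Kᵢ Kⱼ`. -/
def Mw (ω : ℝ) (α : ℕ → ℝ) (n : ℕ) : ℕ :=
  ∑ i ∈ Finset.range (n + 1), Kw ω α i * Kw ω α (n - i)

/-- `M̃ₙ = Σ_{i=0}^n Mᵢ`. -/
def Mtil (ω : ℝ) (α : ℕ → ℝ) (n : ℕ) : ℕ := ∑ i ∈ Finset.range (n + 1), Mw ω α i

/-- The `n`-th approximation number of `T` (1-indexed: `approxNum T n = aₙ(T)` is the
infimum of `‖T - F‖` over bounded operators `F` of rank `< n`).  For operators between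
Hilbert spaces this equals the `n`-th singular number. -/
def approxNum {X Y : Type*} [NormedAddCommGroup X] [NormedSpace ℂ X]
    [NormedAddCommGroup Y] [NormedSpace ℂ Y] (T : X →L[ℂ] Y) (n : ℕ) : ℝ :=
  sInf {c | ∃ F : X →L[ℂ] Y, LinearMap.rank (F : X →ₗ[ℂ] Y) < (n : Cardinal) ∧ c = ‖T - F‖}

/-- The `n`-th Kolmogorov number `dₙ(T)` (1-indexed). -/
def kolNum {X Y : Type*} [NormedAddCommGroup X] [NormedSpace ℂ X]
    [NormedAddCommGroup Y] [NormedSpace ℂ Y] (T : X →L[ℂ] Y) (n : ℕ) : ℝ :=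
  sInf {c | ∃ V : Submodule ℂ Y, Module.rank ℂ V < (n : Cardinal) ∧
    c = ⨆ x : {x : X // ‖x‖ ≤ 1}, ⨅ y : V, ‖T x.1 - (y : Y)‖}

/-- The `n`-th Hilbert number `hₙ(T)` (1-indexed): the supremum of `sₙ(A ∘ T ∘ B)` over
all Hilbert spaces `K`, `H'` and all contractions `B : K → X`, `A : Y → H'`. -/
def hilbertNum {X Y : Type u} [NormedAddCommGroup X] [NormedSpace ℂ X]
    [NormedAddCommGroup Y] [NormedSpace ℂ Y] (T : X →L[ℂ] Y) (n : ℕ) : ℝ :=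
  sSup {c | ∃ (K : Type u) (_ : NormedAddCommGroup K) (_ : InnerProductSpace ℂ K)
    (_ : CompleteSpace K) (H' : Type u) (_ : NormedAddCommGroup H')
    (_ : InnerProductSpace ℂ H') (_ : CompleteSpace H')
    (B : K →L[ℂ] X) (A : Y →L[ℂ] H'), ‖B‖ ≤ 1 ∧ ‖A‖ ≤ 1 ∧
    c = approxNum ((A.comp T).comp B) n}

/-- The sequence of singular numbers of an operator, 0-indexed:
`sSeq T n = s_{n+1}(T) = a_{n+1}(T)`. -/
def sSeq {X Y : Type*} [NormedAddCommGroup X] [NormedSpace ℂ X]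
    [NormedAddCommGroup Y] [NormedSpace ℂ Y] (T : X →L[ℂ] Y) : ℕ → ℝ :=
  fun n => approxNum T (n + 1)

/-- The multiplication operator `M_{a,b} : x ↦ a * x * b` on a normed algebra. -/
def Mop {A : Type*} [NonUnitalNormedRing A] [NormedSpace ℂ A] [IsScalarTower ℂ A A]
    [SMulCommClass ℂ A A] (a b : A) : A →L[ℂ] A :=
  (ContinuousLinearMap.mul ℂ A a).comp ((ContinuousLinearMap.mul ℂ A).flip b)

open scoped TensorProduct

/-- The projective tensor norm on the algebraic tensor product `H ⊗ H`:
`‖u‖_π = inf {Σᵢ ‖xᵢ‖‖yᵢ‖ : u = Σᵢ xᵢ ⊗ yᵢ}`. -/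
def projNorm {H : Type*} [NormedAddCommGroup H] [NormedSpace ℂ H]
    (u : TensorProduct ℂ H H) : ℝ :=
  sInf {r | ∃ l : List (H × H), u = (l.map fun p => p.1 ⊗ₜ[ℂ] p.2).sum ∧
    r = (l.map fun p => ‖p.1‖ * ‖p.2‖).sum}


section aux

variable {H : Type*} [NormedAddCommGroup H] [InnerProductSpace ℂ H]

lemma pythag {J : Type*} (s : Finset J) (v : J → H)
    (h : ∀ i ∈ s, ∀ j ∈ s, i ≠ j → inner ℂ (v i) (v j) = 0) :
    ‖∑ i ∈ s, v i‖ ^ 2 = ∑ i ∈ s, ‖v i‖ ^ 2 := by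
  classical
  induction s using Finset.induction_on with
  | empty => simp
  | insert a s ha ih =>
    rw [Finset.sum_insert ha, Finset.sum_insert ha, ← ih]
    · have := norm_add_sq_eq_norm_sq_add_norm_sq_of_inner_eq_zero (𝕜 := ℂ) (v a) (∑ i ∈ s, v i) (by
        rw [inner_sum]
        apply Finset.sum_eq_zero
        intro j hj
        apply h a (by simp) j (by simp [hj])
        rintro rfl; exact ha hj)
      nlinarith [this]
    · intro i hi j hj
      exact h i (by simp [hi]) j (by simp [hj])

lemma max_vec {K : Type*} [NormedAddCommGroup K] [InnerProductSpace ℂ K] [CompleteSpace K]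
    [CompleteSpace H] (B : K →L[ℂ] H) (hB : IsCompactOperator ⇑B) (h0 : 0 < ‖B‖) :
    ∃ e : K, ‖e‖ = 1 ∧ ∀ y, inner ℂ (B e) (B y) = (‖B‖ ^ 2 : ℝ) * inner ℂ e y := by
  have hex : ∀ n : ℕ, ∃ x : K, ‖x‖ = 1 ∧ ‖B‖ * (1 - 1 / (n + 1)) ≤ ‖B x‖ := by
    intro n
    by_contra hcon
    push Not at hcon
    have hn : (0 : ℝ) < 1 / (n + 1) := by positivity
    have hn1 : (1 : ℝ) / (n + 1) ≤ 1 := by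
      rw [div_le_one (by positivity)]
      have : (0 : ℝ) ≤ n := by positivity
      linarith
    have : ‖B‖ ≤ ‖B‖ * (1 - 1 / (n + 1)) := by
      refine ContinuousLinearMap.opNorm_le_bound _ (by apply mul_nonneg h0.le; linarith) ?_
      intro x
      by_cases hx : x = 0
      · simp [hx]
      have hxp : 0 < ‖x‖ := norm_pos_iff.2 hx
      have := hcon (((‖x‖⁻¹ : ℝ) : ℂ) • x) (by
        rw [norm_smul]; simp [hxp.ne'])
      rw [map_smul, norm_smul] at this
      simp only [Complex.norm_real, norm_inv, norm_norm] at this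
      rw [inv_mul_lt_iff₀ hxp] at this
      linarith
    nlinarith
  choose x hx1 hx2 using hex
  have hC : IsCompactOperator (⇑(B.adjoint ∘L B)) := hB.clm_comp B.adjoint
  obtain ⟨S, hS, hSx⟩ := hC.image_closedBall_subset_compact (𝕜₁ := ℂ) 1
  obtain ⟨y, -, φ, hφ, hy⟩ := hS.tendsto_subseq (x := fun n => (B.adjoint ∘L B) (x n))
    (fun n => hSx ⟨x n, by simp [hx1], rfl⟩)
  have hkey : ∀ n, ‖(B.adjoint ∘L B) (x n) - ((‖B‖ ^ 2 : ℝ) : ℂ) • x n‖ ^ 2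
      ≤ 4 * ‖B‖ ^ 4 * (1 / (n + 1)) := by
    intro n
    rw [@norm_sub_sq ℂ]
    rw [inner_smul_right, norm_smul, hx1]
    have h1 : inner ℂ ((B.adjoint ∘L B) (x n)) (x n) = ((‖B (x n)‖ ^ 2 : ℝ) : ℂ) := by
      simp only [ContinuousLinearMap.comp_apply]
      rw [ContinuousLinearMap.adjoint_inner_left, inner_self_eq_norm_sq_to_K]; simp
    rw [h1]
    have h2 : RCLike.re (((‖B‖ ^ 2 : ℝ) : ℂ) * ((‖B (x n)‖ ^ 2 : ℝ) : ℂ)) = ‖B‖ ^ 2 * ‖B (x n)‖ ^ 2 := by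
      rw [← Complex.ofReal_mul]; simp [-Complex.ofReal_mul, -Complex.ofReal_pow]
    rw [h2]
    have h3 : ‖(B.adjoint ∘L B) (x n)‖ ≤ ‖B‖ ^ 2 := by
      have := (B.adjoint ∘L B).le_opNorm (x n)
      rw [ContinuousLinearMap.norm_adjoint_comp_self, hx1] at this
      nlinarith
    have h4 : ‖(B.adjoint ∘L B) (x n)‖ ^ 2 ≤ (‖B‖ ^ 2) ^ 2 := by gcongr
    have h5 : ‖((‖B‖ ^ 2 : ℝ) : ℂ)‖ = ‖B‖ ^ 2 := by
      rw [Complex.norm_real]; simp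
    rw [h5]
    have hn : (0 : ℝ) < 1 / (n + 1) := by positivity
    have hn1 : (1 : ℝ) / (n + 1) ≤ 1 := by
      rw [div_le_one (by positivity)]
      have : (0 : ℝ) ≤ n := by positivity
      linarith
    have h6 := hx2 n
    generalize (1 : ℝ) / (n + 1) = t at *
    have h7 : (‖B‖ * (1 - t)) ^ 2 ≤ ‖B (x n)‖ ^ 2 := by
      have : 0 ≤ ‖B‖ * (1 - t) := by apply mul_nonneg h0.le; linarith
      gcongr
    have h8 : ‖B‖ ^ 2 * (1 - 2 * t) ≤ ‖B (x n)‖ ^ 2 := by nlinarith [mul_nonneg (sq_nonneg ‖B‖) (sq_nonneg t)]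
    have h9 := mul_le_mul_of_nonneg_left h8 (sq_nonneg ‖B‖)
    nlinarith
  have hlim0 : Filter.Tendsto (fun n => (B.adjoint ∘L B) (x n) - ((‖B‖ ^ 2 : ℝ) : ℂ) • x n)
      Filter.atTop (nhds 0) := by
    rw [tendsto_zero_iff_norm_tendsto_zero]
    have : Filter.Tendsto (fun n : ℕ => Real.sqrt (4 * ‖B‖ ^ 4 * (1 / ((n : ℝ) + 1)))) Filter.atTop (nhds 0) := by
      have h := (tendsto_one_div_add_atTop_nhds_zero_nat (𝕜 := ℝ)).const_mul (4 * ‖B‖ ^ 4)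
      have h' := (Real.continuous_sqrt.tendsto _).comp h
      rw [mul_zero, Real.sqrt_zero] at h'
      exact h'
    refine squeeze_zero (fun n => norm_nonneg _) (fun n => ?_) this
    exact Real.le_sqrt_of_sq_le (hkey n)
  set c : ℂ := ((‖B‖ ^ 2 : ℝ) : ℂ) with hc
  have hc0 : c ≠ 0 := by
    rw [hc]; exact_mod_cast (by positivity : ‖B‖ ^ 2 ≠ 0)
  have hlim1 : Filter.Tendsto (fun n => x (φ n)) Filter.atTop (nhds (c⁻¹ • y)) := by
    have h := (hy.sub (hlim0.comp hφ.tendsto_atTop)).const_smul c⁻¹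
    simp only [sub_zero] at h
    refine h.congr ?_
    intro n
    simp [smul_smul, hc0]
  refine ⟨c⁻¹ • y, ?_, ?_⟩
  · have := hlim1.norm
    simp only [hx1] at this
    exact (tendsto_nhds_unique tendsto_const_nhds this).symm
  · intro z
    have hz : (B.adjoint ∘L B) (c⁻¹ • y) = c • (c⁻¹ • y) := by
      have h1 := ((B.adjoint ∘L B).continuous.tendsto _).comp hlim1
      have h2 := tendsto_nhds_unique h1 hy
      rw [h2, smul_smul, mul_inv_cancel₀ hc0, one_smul]
    rw [← ContinuousLinearMap.adjoint_inner_left]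
    have : (B.adjoint (B (c⁻¹ • y))) = c • (c⁻¹ • y) := hz
    rw [this, inner_smul_left, hc, Complex.conj_ofReal]

end aux

section aux2

variable {H : Type*} [NormedAddCommGroup H] [InnerProductSpace ℂ H] [CompleteSpace H]

lemma svd_set (A : H →L[ℂ] H) (hA : IsCompactOperator ⇑A) (δ : ℝ) (hδ : 0 < δ) :
    ∃ s : Set H, s.Finite ∧ Orthonormal ℂ (Subtype.val : s → H) ∧
      (∀ v ∈ s, δ < ‖A v‖ ∧ ∀ y, inner ℂ (A v) (A y) = (‖A v‖ ^ 2 : ℝ) * inner ℂ v y) ∧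
      ∀ x, (∀ v ∈ s, inner ℂ v x = 0) → ‖A x‖ ≤ δ * ‖x‖ := by
  obtain ⟨m, hm⟩ := zorn_subset {s : Set H | Orthonormal ℂ (Subtype.val : s → H) ∧
      (∀ v ∈ s, δ < ‖A v‖ ∧ ∀ y, inner ℂ (A v) (A y) = (‖A v‖ ^ 2 : ℝ) * inner ℂ v y)} (by
    intro c hc cc
    refine ⟨⋃₀ c, ⟨?_, ?_⟩, fun _ => Set.subset_sUnion_of_mem⟩
    · exact orthonormal_sUnion_of_directed cc.directedOn fun x xc => (hc xc).1
    · rintro v ⟨t, ht, hv⟩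
      exact (hc ht).2 v hv)
  obtain ⟨hmo, hme⟩ := hm.prop
  refine ⟨m, ?_, hmo, hme, ?_⟩
  · by_contra hinf
    have hinf : m.Infinite := hinf
    let f := hinf.natEmbedding
    obtain ⟨S, hS, hSx⟩ := hA.image_closedBall_subset_compact (𝕜₁ := ℂ) (f := (A : H →ₗ[ℂ] H)) 1
    obtain ⟨y, -, φ, hφ, hy⟩ := hS.tendsto_subseq (x := fun n => A (f n : H))
      (fun n => hSx ⟨(f n : H), by simpa using (hmo.1 (f n)).le, rfl⟩)
    have hc := hy.cauchySeq
    rw [Metric.cauchySeq_iff] at hc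
    obtain ⟨M, hM⟩ := hc δ hδ
    have h1 := hM M le_rfl (M + 1) (by omega)
    simp only [Function.comp] at h1
    rw [dist_eq_norm] at h1
    set a := f (φ M)
    set b := f (φ (M + 1))
    have hab : a ≠ b := by
      intro h
      have := hφ.injective (f.injective h)
      omega
    have h2 : inner ℂ (A a) (A b) = 0 := by
      rw [(hme a a.2).2, hmo.2 hab, mul_zero]
    have h3 : ‖A a - A b‖ ^ 2 = ‖A a‖ ^ 2 + ‖A b‖ ^ 2 := by
      rw [@norm_sub_sq ℂ, h2]; simp
    have h4 := (hme a a.2).1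
    have h5 : ‖A a - A b‖ ^ 2 < δ ^ 2 := by gcongr
    have h6 : δ ^ 2 < ‖A a‖ ^ 2 := by gcongr
    nlinarith [sq_nonneg ‖A b‖]
  · intro x hx
    set K : Submodule ℂ H := (Submodule.span ℂ m)ᗮ with hK
    have hKmem : ∀ x, x ∈ K ↔ ∀ v ∈ m, inner ℂ v x = 0 := by
      intro x
      rw [hK, Submodule.mem_orthogonal]
      constructor
      · intro h v hv
        exact h v (Submodule.subset_span hv)
      · intro h u hu
        induction hu using Submodule.span_induction with
        | mem x hx => exact h x hx
        | zero => simp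
        | add x y _ _ hx hy => rw [inner_add_left, hx, hy, add_zero]
        | smul a x _ hx => rw [inner_smul_left, hx, mul_zero]
    set B : K →L[ℂ] H := A ∘L K.subtypeL with hB
    have hBc : IsCompactOperator ⇑B := hA.comp_clm K.subtypeL
    have hle : ‖B‖ ≤ δ := by
      by_contra hcon
      push Not at hcon
      obtain ⟨e, he1, he2⟩ := max_vec B hBc (hδ.trans hcon)
      have hBe : ‖A (e : H)‖ = ‖B‖ := by
        have h := he2 e
        rw [inner_self_eq_norm_sq_to_K, inner_self_eq_norm_sq_to_K, he1] at h
        have h' : ‖B e‖ ^ 2 = ‖B‖ ^ 2 := by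
          have h'' : ((‖B e‖ ^ 2 : ℝ) : ℂ) = ((‖B‖ ^ 2 : ℝ) : ℂ) := by
            simpa using h
          exact_mod_cast h''
        have := (sq_eq_sq₀ (norm_nonneg (B e)) (norm_nonneg B)).1 h'
        exact this
      have heig : ∀ y, inner ℂ (A (e : H)) (A y) = (‖A (e : H)‖ ^ 2 : ℝ) * inner ℂ (e : H) y := by
        have hdK : A.adjoint (A (e : H)) - ((‖B‖ ^ 2 : ℝ) : ℂ) • (e : H) ∈ K := by
          apply K.sub_mem _ (K.smul_mem _ e.2)
          rw [hKmem]
          intro v hv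
          rw [ContinuousLinearMap.adjoint_inner_right, (hme v hv).2, (hKmem e).1 e.2 v hv, mul_zero]
        have hd0 : A.adjoint (A (e : H)) - ((‖B‖ ^ 2 : ℝ) : ℂ) • (e : H) = 0 := by
          rw [← inner_self_eq_zero (𝕜 := ℂ)]
          set w : K := ⟨_, hdK⟩ with hw
          have h := he2 w
          have hww : A.adjoint (A (e : H)) - ((‖B‖ ^ 2 : ℝ) : ℂ) • (e : H) = (w : H) := rfl
          nth_rewrite 2 [hww]
          rw [inner_sub_left, ContinuousLinearMap.adjoint_inner_left, inner_smul_left,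
            Complex.conj_ofReal]
          rw [sub_eq_zero]
          exact h
        intro y
        rw [← ContinuousLinearMap.adjoint_inner_left, sub_eq_zero.1 hd0, inner_smul_left,
          Complex.conj_ofReal, hBe]
      have hnot : (e : H) ∉ m := by
        intro hem
        have := (hKmem e).1 e.2 _ hem
        rw [inner_self_eq_zero] at this
        have h0 : e = 0 := by exact_mod_cast this
        rw [h0] at he1
        simp at he1
      have hins : insert (e : H) m ∈ {s : Set H | Orthonormal ℂ (Subtype.val : s → H) ∧
          (∀ v ∈ s, δ < ‖A v‖ ∧ ∀ y, inner ℂ (A v) (A y) = (‖A v‖ ^ 2 : ℝ) * inner ℂ v y)} := by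
        refine ⟨⟨?_, ?_⟩, ?_⟩
        · rintro ⟨v, hv⟩
          rcases hv with rfl | hv
          · simpa using he1
          · exact hmo.1 ⟨v, hv⟩
        · rintro ⟨v, hv⟩ ⟨w, hw⟩ hvw
          have hvw' : v ≠ w := fun h => hvw (Subtype.ext h)
          rcases hv with rfl | hv <;> rcases hw with rfl | hw
          · exact absurd rfl hvw'
          · exact inner_eq_zero_symm.1 ((hKmem e).1 e.2 w hw)
          · exact (hKmem e).1 e.2 v hv
          · exact hmo.2 (i := ⟨v, hv⟩) (j := ⟨w, hw⟩) (fun h => hvw' (congrArg Subtype.val h))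
        · rintro v (rfl | hv)
          · exact ⟨by rw [hBe]; exact hcon, heig⟩
          · exact hme v hv
      exact hnot (hm.le_of_ge hins (Set.subset_insert _ _) (Set.mem_insert _ _))
    have := B.le_opNorm ⟨x, (hKmem x).2 hx⟩
    refine this.trans ?_
    have h2 : ‖(⟨x, (hKmem x).2 hx⟩ : K)‖ = ‖x‖ := rfl
    rw [h2]
    gcongr

lemma svd (A : H →L[ℂ] H) (hA : IsCompactOperator ⇑A) (δ : ℝ) (hδ : 0 < δ) :
    ∃ (d : ℕ) (e : Fin d → H), Orthonormal ℂ e ∧ (∀ i, δ < ‖A (e i)‖) ∧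
      (∀ i y, inner ℂ (A (e i)) (A y) = (‖A (e i)‖ ^ 2 : ℝ) * inner ℂ (e i) y) ∧
      Antitone (fun i => ‖A (e i)‖) ∧
      ∀ x, (∀ i, inner ℂ (e i) x = 0) → ‖A x‖ ≤ δ * ‖x‖ := by
  obtain ⟨s, hsf, hso, hse, hsx⟩ := svd_set A hA δ hδ
  have : Fintype s := hsf.fintype
  let g : Fin (Fintype.card s) ≃ s := (Fintype.equivFin s).symm
  let π := Tuple.sort (fun i => -‖A (g i : H)‖)
  have hmono := Tuple.monotone_sort (fun i => -‖A (g i : H)‖)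
  refine ⟨Fintype.card s, fun i => (g (π i) : H), ?_, ?_, ?_, ?_, ?_⟩
  · exact hso.comp (fun i => g (π i)) (g.injective.comp π.injective)
  · intro i; exact (hse _ (g (π i)).2).1
  · intro i; exact (hse _ (g (π i)).2).2
  · intro i j hij
    have := hmono hij
    simp only [Function.comp] at this
    exact neg_le_neg_iff.1 this
  · intro x hx
    apply hsx
    intro v hv
    have := hx (π.symm (g.symm ⟨v, hv⟩))
    simpa using this

lemma svd_lower (A : H →L[ℂ] H) {d : ℕ} (e : Fin d → H) (heo : Orthonormal ℂ e)
    (hee : ∀ i y, inner ℂ (A (e i)) (A y) = (‖A (e i)‖ ^ 2 : ℝ) * inner ℂ (e i) y)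
    (hanti : Antitone (fun i => ‖A (e i)‖)) (i : Fin d) : ‖A (e i)‖ ≤ sSeq A i := by
  unfold sSeq approxNum
  apply le_csInf
  · refine ⟨_, 0, ?_, rfl⟩
    have : ((0 : H →L[ℂ] H) : H →ₗ[ℂ] H) = 0 := rfl
    rw [this, LinearMap.rank_zero]
    exact_mod_cast Nat.succ_pos _
  rintro c ⟨F, hF, rfl⟩
  let j : Fin (i + 1) → Fin d := fun k => ⟨k, by omega⟩
  have hj : Function.Injective j := by
    intro a b h
    simp only [j, Fin.mk.injEq] at h
    exact Fin.ext h
  let L : (Fin (i + 1) → ℂ) →ₗ[ℂ] H := Fintype.linearCombination ℂ (fun k => e (j k))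
  let G : (Fin (i + 1) → ℂ) →ₗ[ℂ] LinearMap.range (F : H →ₗ[ℂ] H) :=
    (F : H →ₗ[ℂ] H).rangeRestrict.comp L
  have hfin : FiniteDimensional ℂ (LinearMap.range (F : H →ₗ[ℂ] H)) := by
    exact Module.rank_lt_aleph0_iff.1 (hF.trans (Cardinal.natCast_lt_aleph0))
  have hfr : Module.finrank ℂ (LinearMap.range (F : H →ₗ[ℂ] H)) < i + 1 := by
    have h := hF
    unfold LinearMap.rank at h
    rw [← Module.finrank_eq_rank] at h
    exact_mod_cast h
  have hker : LinearMap.ker G ≠ ⊥ := by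
    apply LinearMap.ker_ne_bot_of_finrank_lt
    simpa using hfr
  obtain ⟨v, hv, hv0⟩ := Submodule.exists_mem_ne_zero_of_ne_bot hker
  have hFv : F (L v) = 0 := by
    have : G v = 0 := hv
    have := congrArg Subtype.val this
    simpa [G] using this
  have hLv : L v = ∑ k, v k • e (j k) := by
    simp [L, Fintype.linearCombination_apply]
  have h1 : ‖L v‖ ^ 2 = ∑ k, ‖v k‖ ^ 2 := by
    rw [hLv, pythag]
    · apply Finset.sum_congr rfl
      intro k _
      rw [norm_smul, heo.1, mul_one]
    · intro a _ b _ hab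
      rw [inner_smul_left, inner_smul_right, heo.2 (fun h => hab (hj h))]; simp
  have h2 : ‖A (L v)‖ ^ 2 = ∑ k, ‖v k‖ ^ 2 * ‖A (e (j k))‖ ^ 2 := by
    rw [hLv, map_sum, pythag]
    · apply Finset.sum_congr rfl
      intro k _
      rw [map_smul, norm_smul, mul_pow]
    · intro a _ b _ hab
      rw [map_smul, map_smul, inner_smul_left, inner_smul_right, hee,
        heo.2 (fun h => hab (hj h))]; simp
  have h3 : ‖A (e i)‖ ^ 2 * ‖L v‖ ^ 2 ≤ ‖A (L v)‖ ^ 2 := by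
    rw [h1, h2, Finset.mul_sum]
    apply Finset.sum_le_sum
    intro k _
    rw [mul_comm]
    have : ‖A (e i)‖ ≤ ‖A (e (j k))‖ := hanti (by
      rw [Fin.le_def]; simp only [j]; omega)
    gcongr
  have hLpos : 0 < ‖L v‖ := by
    have : 0 < ‖L v‖ ^ 2 := by
      rw [h1]
      obtain ⟨k, hk⟩ := Function.ne_iff.1 hv0
      apply Finset.sum_pos' (fun _ _ => by positivity)
      exact ⟨k, Finset.mem_univ _, by have := norm_pos_iff.2 hk; positivity⟩
    exact (norm_nonneg _).lt_of_ne (fun h => by rw [← h] at this; simp at this)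
  have h4 : ‖A (e i)‖ * ‖L v‖ ≤ ‖A (L v)‖ := by
    rw [← mul_pow] at h3
    exact le_of_sq_le_sq h3 (norm_nonneg _)
  have h5 : ‖A (L v)‖ ≤ ‖A - F‖ * ‖L v‖ := by
    have := (A - F).le_opNorm (L v)
    simpa [hFv] using this
  exact le_of_mul_le_mul_right (h4.trans h5) hLpos

end aux2

section aux3

lemma fourier_coeff {Z : Type*} [NormedAddCommGroup Z] [NormedSpace ℂ Z] (M : ℕ) (h : ℕ → Z) (C : ℝ)
    (hC : ∀ z : ℂ, ‖z‖ = 1 → ‖∑ q ∈ Finset.range M, z ^ q • h q‖ ≤ C) (p : ℕ) (hp : p < M) :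
    ‖h p‖ ≤ C := by
  have hM : M ≠ 0 := by omega
  set ζ : ℂ := Complex.exp (2 * Real.pi * Complex.I / M) with hζ
  have hprim : IsPrimitiveRoot ζ M := Complex.isPrimitiveRoot_exp M hM
  have hn : ‖ζ‖ = 1 := hprim.norm'_eq_one hM
  have hζ0 : ζ ≠ 0 := by intro h0; rw [h0] at hn; simp at hn
  have horth : ∀ q ∈ Finset.range M, ∑ s ∈ Finset.range M, (ζ ^ q / ζ ^ p) ^ s =
      if q = p then (M : ℂ) else 0 := by
    intro q hq
    split_ifs with hqp
    · rw [hqp, div_self (pow_ne_zero _ hζ0)]; simp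
    · have hw : ζ ^ q / ζ ^ p ≠ 1 := by
        intro h1
        rw [div_eq_one_iff_eq (pow_ne_zero _ hζ0)] at h1
        exact hqp (hprim.pow_inj (Finset.mem_range.1 hq) hp h1)
      have hwM : (ζ ^ q / ζ ^ p) ^ M = 1 := by
        rw [div_pow, ← pow_mul, ← pow_mul, mul_comm q, mul_comm p, pow_mul, pow_mul,
          hprim.pow_eq_one]; simp
      rw [geom_sum_eq hw, hwM]; simp
  have hsum : (M : ℂ) • h p = ∑ s ∈ Finset.range M, ((ζ ^ p) ^ s)⁻¹ •
      ∑ q ∈ Finset.range M, (ζ ^ s) ^ q • h q := by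
    simp_rw [Finset.smul_sum, smul_smul]
    rw [Finset.sum_comm]
    have : ∀ q ∈ Finset.range M, ∑ s ∈ Finset.range M, (((ζ ^ p) ^ s)⁻¹ * (ζ ^ s) ^ q) • h q =
        if q = p then (M : ℂ) • h p else 0 := by
      intro q hq
      rw [← Finset.sum_smul]
      have h1 : ∑ s ∈ Finset.range M, (((ζ ^ p) ^ s)⁻¹ * (ζ ^ s) ^ q) =
          ∑ s ∈ Finset.range M, (ζ ^ q / ζ ^ p) ^ s := by
        apply Finset.sum_congr rfl
        intro s _
        rw [div_pow, ← pow_mul ζ s q, mul_comm s q, pow_mul]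
        field_simp
      rw [h1, horth q hq]
      split_ifs with hqp
      · rw [hqp]
      · simp
    rw [Finset.sum_congr rfl this]
    simp [hp]
  have hnorm : (M : ℝ) * ‖h p‖ ≤ M * C := by
    have h1 : ‖(M : ℂ) • h p‖ = M * ‖h p‖ := by rw [norm_smul]; simp
    rw [← h1, hsum]
    refine (norm_sum_le _ _).trans ?_
    have : ∀ s ∈ Finset.range M, ‖((ζ ^ p) ^ s)⁻¹ • ∑ q ∈ Finset.range M, (ζ ^ s) ^ q • h q‖ ≤ C := by
      intro s _
      rw [norm_smul]
      have h2 := hC (ζ ^ s) (by simp [hn])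
      simpa [hn] using h2
    refine (Finset.sum_le_sum this).trans ?_
    simp
  have : (0 : ℝ) < M := by positivity
  exact le_of_mul_le_mul_left hnorm this

lemma tail_bound {Z : Type*} [NormedAddCommGroup Z] [NormedSpace ℂ Z] (N : ℕ) (g : ℕ → ℕ → Z)
    (C ω : ℝ) (h0 : 0 < ω) (h1 : ω < 1) (hC0 : 0 ≤ C)
    (hC : ∀ z : ℂ, ‖z‖ = 1 → ‖∑ k ∈ Finset.range (N + 1), ∑ l ∈ Finset.range (N + 1),
      ((z * (ω : ℂ)⁻¹) ^ k * (z * (ω : ℂ)⁻¹) ^ l) • g k l‖ ≤ C) :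
    ‖∑ k ∈ Finset.range (N + 1), ∑ l ∈ Finset.range (N + 1), (if k + l < N then 0 else g k l)‖
      ≤ C * (ω ^ N / (1 - ω)) := by
  let Q := Finset.range (N + 1) ×ˢ Finset.range (N + 1)
  let h : ℕ → Z := fun p => ∑ x ∈ Q with x.1 + x.2 = p, g x.1 x.2
  have hmaps : ∀ x ∈ Q, x.1 + x.2 ∈ Finset.range (2 * N + 1) := by
    intro x hx
    simp only [Q, Finset.mem_product, Finset.mem_range] at hx ⊢
    omega
  have hω : (ω : ℂ) ≠ 0 := by exact_mod_cast h0.ne'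
  have hF : ∀ p < 2 * N + 1, ‖((ω : ℂ)⁻¹) ^ p • h p‖ ≤ C := by
    intro p hp
    refine fourier_coeff (2 * N + 1) (fun p => ((ω : ℂ)⁻¹) ^ p • h p) C ?_ p hp
    intro z hz
    refine le_of_eq_of_le ?_ (hC z hz)
    congr 1
    rw [← Finset.sum_product' (s := Finset.range (N + 1)) (t := Finset.range (N + 1))
      (f := fun k l => ((z * (ω : ℂ)⁻¹) ^ k * (z * (ω : ℂ)⁻¹) ^ l) • g k l)]
    rw [← Finset.sum_fiberwise_of_maps_to hmaps]
    apply Finset.sum_congr rfl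
    intro q _
    simp only [h]
    rw [smul_smul, Finset.smul_sum]
    apply Finset.sum_congr rfl
    intro x hx
    rw [← (Finset.mem_filter.1 hx).2, ← pow_add, mul_pow]
  have hF' : ∀ p < 2 * N + 1, ‖h p‖ ≤ C * ω ^ p := by
    intro p hp
    have := hF p hp
    rw [norm_smul, norm_pow, norm_inv, Complex.norm_real, Real.norm_of_nonneg h0.le, inv_pow,
      inv_mul_le_iff₀ (by positivity)] at this
    linarith
  have hsplit : ∑ k ∈ Finset.range (N + 1), ∑ l ∈ Finset.range (N + 1),
      (if k + l < N then 0 else g k l) = ∑ j ∈ Finset.range (N + 1), h (N + j) := by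
    rw [← Finset.sum_product' (s := Finset.range (N + 1)) (t := Finset.range (N + 1))
      (f := fun k l => (if k + l < N then 0 else g k l))]
    rw [← Finset.sum_fiberwise_of_maps_to hmaps]
    have h2N : 2 * N + 1 = N + (N + 1) := by ring
    rw [h2N, Finset.sum_range_add, Finset.sum_eq_zero, zero_add]
    · apply Finset.sum_congr rfl
      intro q _
      apply Finset.sum_congr rfl
      intro x hx
      have := (Finset.mem_filter.1 hx).2
      rw [if_neg (by omega)]
    · intro q hq
      apply Finset.sum_eq_zero
      intro x hx
      have := (Finset.mem_filter.1 hx).2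
      have := Finset.mem_range.1 hq
      rw [if_pos (by omega)]
  rw [hsplit]
  refine (norm_sum_le _ _).trans ?_
  have : ∀ j ∈ Finset.range (N + 1), ‖h (N + j)‖ ≤ C * ω ^ N * ω ^ j := by
    intro j hj
    have := hF' (N + j) (by have := Finset.mem_range.1 hj; omega)
    rwa [pow_add, ← mul_assoc] at this
  refine (Finset.sum_le_sum this).trans ?_
  rw [← Finset.mul_sum, div_eq_mul_inv, ← mul_assoc]
  have hgeo : ∑ j ∈ Finset.range (N + 1), ω ^ j ≤ (1 - ω)⁻¹ := by
    rw [← tsum_geometric_of_lt_one h0.le h1]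
    exact (summable_geometric_of_lt_one h0.le h1).sum_le_tsum _ (fun _ _ => by positivity)
  gcongr

end aux3

section aux4

variable {H : Type*} [NormedAddCommGroup H] [InnerProductSpace ℂ H] [CompleteSpace H]

lemma blocks (A : H →L[ℂ] H) (hA : IsCompactOperator ⇑A) (α ω : ℝ) (hα : ‖A‖ ≤ α) (hα0 : 0 < α)
    (h0 : 0 < ω) (h1 : ω < 1) (N : ℕ) :
    ∃ (Ak : ℕ → H →L[ℂ] H) (f : ℕ → H) (I : ℕ → Finset ℕ),
      A = ∑ k ∈ Finset.range (N + 1), Ak k ∧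
      (∀ z : ℂ, ‖z‖ = 1 → ‖∑ k ∈ Finset.range (N + 1), (z * (ω : ℂ)⁻¹) ^ k • Ak k‖ ≤ α) ∧
      (∀ k < N, ∀ i ∈ I k, α * ω ^ (k + 1) < sSeq A i) ∧
      (∀ k < N, ∀ x, Ak k x ∈ Submodule.span ℂ (f '' (I k : Set ℕ))) := by
  classical
  obtain ⟨d, e, heo, hδ, hee, hanti, hx⟩ := svd A hA (α * ω ^ N) (by positivity)
  have hlow := svd_lower A e heo hee hanti
  have hκ : ∀ i, ∃ k : ℕ, α * ω ^ (k + 1) < ‖A (e i)‖ ∧ ‖A (e i)‖ ≤ α * ω ^ k := by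
    intro i
    have hp : 0 < ‖A (e i)‖ := lt_trans (by positivity) (hδ i)
    have hle : ‖A (e i)‖ ≤ α := by
      have := A.le_opNorm (e i)
      rw [heo.1, mul_one] at this
      exact this.trans hα
    obtain ⟨k, hk1, hk2⟩ := exists_nat_pow_near_of_lt_one (x := ‖A (e i)‖ / α) (y := ω)
      (by positivity) ((div_le_one hα0).2 hle) h0 h1
    refine ⟨k, ?_, ?_⟩
    · rw [lt_div_iff₀ hα0] at hk1; linarith
    · rw [div_le_iff₀ hα0] at hk2; linarith
  choose κ hκ1 hκ2 using hκ
  have hκN : ∀ i, κ i < N := by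
    intro i
    by_contra hc
    push Not at hc
    have h2 : ω ^ κ i ≤ ω ^ N := pow_le_pow_of_le_one h0.le h1.le hc
    have h3 := mul_le_mul_of_nonneg_left h2 hα0.le
    linarith [hδ i, hκ2 i]
  let R : Fin d → H →L[ℂ] H := fun i => (innerSL ℂ (e i)).smulRight (A (e i))
  let Ak : ℕ → H →L[ℂ] H := fun k => if k < N then ∑ i with κ i = k, R i else A - ∑ i, R i
  have hcomb : ∀ c : ℕ → ℂ, ∑ k ∈ Finset.range (N + 1), c k • Ak k =
      ∑ i, c (κ i) • R i + c N • (A - ∑ i, R i) := by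
    intro c
    rw [Finset.sum_range_succ]
    congr 1
    · rw [← Finset.sum_fiberwise_of_maps_to (s := Finset.univ) (t := Finset.range N) (g := κ)
        (fun i _ => Finset.mem_range.2 (hκN i))]
      apply Finset.sum_congr rfl
      intro k hk
      simp only [Ak, if_pos (Finset.mem_range.1 hk), Finset.smul_sum]
      apply Finset.sum_congr rfl
      intro i hi
      rw [(Finset.mem_filter.1 hi).2]
    · simp [Ak]
  refine ⟨Ak, fun n => if h : n < d then A (e ⟨n, h⟩) else 0,
    fun k => (Finset.univ.filter (fun i => κ i = k)).map Fin.valEmbedding, ?_, ?_, ?_, ?_⟩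
  · have := hcomb (fun _ => 1)
    simp only [one_smul] at this
    rw [this]; abel
  · intro z hz
    rw [hcomb (fun k => (z * (ω : ℂ)⁻¹) ^ k)]
    have hcn : ∀ k : ℕ, ‖(z * (ω : ℂ)⁻¹) ^ k‖ = (ω ^ k)⁻¹ := by
      intro k
      rw [norm_pow, norm_mul, hz, one_mul, norm_inv, Complex.norm_real, Real.norm_of_nonneg h0.le,
        inv_pow]
    refine ContinuousLinearMap.opNorm_le_bound _ hα0.le ?_
    intro x
    set c : ℕ → ℂ := fun k => (z * (ω : ℂ)⁻¹) ^ k with hc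
    set r : H := x - ∑ i, inner ℂ (e i) x • e i with hr
    have hrorth : ∀ i, inner ℂ (e i) r = 0 := by
      intro i
      rw [hr, inner_sub_right, heo.inner_right_fintype, sub_self]
    have happ : (∑ i, c (κ i) • R i + c N • (A - ∑ i, R i)) x =
        ∑ i, (c (κ i) * inner ℂ (e i) x) • A (e i) + c N • A r := by
      simp [R, hr, smul_smul]
    have hxr : x = ∑ i, inner ℂ (e i) x • e i + r := by rw [hr]; abel
    have hxn : ‖x‖ ^ 2 = ∑ i, ‖inner ℂ (e i) x‖ ^ 2 + ‖r‖ ^ 2 := by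
      have h2 := norm_add_sq_eq_norm_sq_add_norm_sq_of_inner_eq_zero (𝕜 := ℂ)
        (∑ i, inner ℂ (e i) x • e i) r (by
          rw [sum_inner]; apply Finset.sum_eq_zero; intro i _
          rw [inner_smul_left, hrorth, mul_zero])
      rw [← hxr] at h2
      rw [sq, h2, ← sq, pythag, ← sq]
      · congr 1
        apply Finset.sum_congr rfl
        intro i _
        rw [norm_smul, heo.1, mul_one]
      · intro a _ b _ hab
        rw [inner_smul_left, inner_smul_right, heo.2 hab]; simp
    have hyn : ‖∑ i, (c (κ i) * inner ℂ (e i) x) • A (e i) + c N • A r‖ ^ 2 =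
        ∑ i, (‖c (κ i)‖ * ‖inner ℂ (e i) x‖ * ‖A (e i)‖) ^ 2 + (‖c N‖ * ‖A r‖) ^ 2 := by
      have h2 := norm_add_sq_eq_norm_sq_add_norm_sq_of_inner_eq_zero (𝕜 := ℂ)
        (∑ i, (c (κ i) * inner ℂ (e i) x) • A (e i)) (c N • A r) (by
          rw [sum_inner]; apply Finset.sum_eq_zero; intro i _
          rw [inner_smul_left, inner_smul_right, hee, hrorth]; simp)
      rw [sq, h2, ← sq, pythag, ← sq]
      · rw [norm_smul]
        congr 1
        apply Finset.sum_congr rfl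
        intro i _
        rw [norm_smul, norm_mul]
      · intro a _ b _ hab
        rw [inner_smul_left, inner_smul_right, hee, heo.2 hab]; simp
    rw [happ]
    apply le_of_sq_le_sq _ (by positivity)
    rw [hyn, mul_pow α, hxn, mul_add, Finset.mul_sum]
    have hcA : ∀ k : ℕ, ∀ t : ℝ, t ≤ α * ω ^ k → ‖c k‖ * t ≤ α := by
      intro k t ht
      rw [hc, hcn, inv_mul_le_iff₀ (by positivity)]
      linarith
    refine add_le_add (Finset.sum_le_sum ?_) ?_
    · intro i _
      have := hcA (κ i) _ (hκ2 i)
      rw [← mul_pow, mul_right_comm]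
      gcongr
    · rw [← mul_pow]
      refine pow_le_pow_left₀ (by positivity) ?_ 2
      have h3 := hx r hrorth
      rw [hc, hcn, inv_mul_le_iff₀ (by positivity)]
      linarith
  · intro k _ i hi
    simp only [Finset.mem_map, Finset.mem_filter, Finset.mem_univ, true_and] at hi
    obtain ⟨j, rfl, rfl⟩ := hi
    exact (hκ1 j).trans_le (hlow j)
  · intro k hk x
    simp only [Ak, if_pos hk]
    rw [_root_.sum_apply]
    apply Submodule.sum_mem
    intro i hi
    simp only [R, ContinuousLinearMap.smulRight_apply]
    apply Submodule.smul_mem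
    apply Submodule.subset_span
    refine ⟨i, ?_, ?_⟩
    · simp only [Finset.coe_map, Set.mem_image, Finset.mem_coe]
      exact ⟨i, hi, rfl⟩
    · simp

end aux4

section aux5

variable {H : Type*} [NormedAddCommGroup H] [InnerProductSpace ℂ H]

lemma projNorm_set_nonempty (u : TensorProduct ℂ H H) :
    ∃ l : List (H × H), u = (l.map fun p => p.1 ⊗ₜ[ℂ] p.2).sum := by
  induction u using TensorProduct.induction_on with
  | zero => exact ⟨[], by simp⟩
  | tmul x y => exact ⟨[(x, y)], by simp⟩
  | add u v hu hv =>
    obtain ⟨l, hl⟩ := hu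
    obtain ⟨l', hl'⟩ := hv
    exact ⟨l ++ l', by simp [← hl, ← hl']⟩

lemma list_norm_nonneg (l : List (H × H)) : 0 ≤ (l.map fun p => ‖p.1‖ * ‖p.2‖).sum := by
  apply List.sum_nonneg
  intro x hx
  obtain ⟨p, -, rfl⟩ := List.mem_map.1 hx
  positivity

lemma projNorm_map_le (X Y : H →L[ℂ] H) (u : TensorProduct ℂ H H) :
    projNorm (TensorProduct.map X.toLinearMap Y.toLinearMap u) ≤ ‖X‖ * ‖Y‖ * projNorm u := by
  have hpos : 0 ≤ ‖X‖ * ‖Y‖ := by positivity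
  have key : ∀ r ∈ {r | ∃ l : List (H × H), u = (l.map fun p => p.1 ⊗ₜ[ℂ] p.2).sum ∧
      r = (l.map fun p => ‖p.1‖ * ‖p.2‖).sum},
      projNorm (TensorProduct.map X.toLinearMap Y.toLinearMap u) ≤ ‖X‖ * ‖Y‖ * r := by
    rintro r ⟨l, hl, rfl⟩
    have h1 : projNorm (TensorProduct.map X.toLinearMap Y.toLinearMap u) ≤
        ((l.map fun p => (X p.1, Y p.2)).map fun p => ‖p.1‖ * ‖p.2‖).sum := by
      apply csInf_le
      · refine ⟨0, ?_⟩
        rintro _ ⟨l', -, rfl⟩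
        exact list_norm_nonneg l'
      · refine ⟨l.map fun p => (X p.1, Y p.2), ?_, rfl⟩
        rw [hl, map_list_sum, List.map_map, List.map_map]
        rfl
    refine h1.trans ?_
    rw [List.map_map, ← List.sum_map_mul_left]
    apply List.sum_le_sum
    intro p _
    simp only [Function.comp]
    have h2 := X.le_opNorm p.1
    have h3 := Y.le_opNorm p.2
    calc ‖X p.1‖ * ‖Y p.2‖ ≤ (‖X‖ * ‖p.1‖) * (‖Y‖ * ‖p.2‖) := by gcongr
      _ = _ := by ring
  by_cases h0 : ‖X‖ * ‖Y‖ = 0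
  · obtain ⟨l, hl⟩ := projNorm_set_nonempty u
    have := key _ ⟨l, hl, rfl⟩
    rw [h0, zero_mul] at this ⊢
    exact this
  · have hp : 0 < ‖X‖ * ‖Y‖ := lt_of_le_of_ne hpos (Ne.symm h0)
    rw [← div_le_iff₀' hp]
    apply le_csInf
    · obtain ⟨l, hl⟩ := projNorm_set_nonempty u
      exact ⟨_, l, hl, rfl⟩
    · intro r hr
      rw [div_le_iff₀' hp]
      exact key r hr

lemma map_sum_sum (N : ℕ) (c : ℕ → ℂ) (X Y : ℕ → H →L[ℂ] H) (u : TensorProduct ℂ H H) :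
    TensorProduct.map (∑ k ∈ Finset.range N, c k • X k).toLinearMap
      (∑ k ∈ Finset.range N, c k • Y k).toLinearMap u =
    ∑ k ∈ Finset.range N, ∑ l ∈ Finset.range N, (c k * c l) •
      TensorProduct.map (X k).toLinearMap (Y l).toLinearMap u := by
  induction u using TensorProduct.induction_on with
  | zero => simp
  | tmul x y =>
    simp only [TensorProduct.map_tmul, ContinuousLinearMap.coe_coe, _root_.sum_apply,
      _root_.smul_apply, TensorProduct.sum_tmul, TensorProduct.tmul_sum,
      TensorProduct.smul_tmul_smul]
    rw [Finset.sum_comm]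
  | add u v hu hv =>
    simp only [map_add, hu, hv, smul_add, Finset.sum_add_distrib]

lemma key_bound {Z : Type*} [CompleteSpace H]
    [NormedAddCommGroup Z] [NormedSpace ℂ Z] [CompleteSpace Z]
    (A B : H →L[ℂ] H) (hA : IsCompactOperator ⇑A) (hB : IsCompactOperator ⇑B)
    (ι : TensorProduct ℂ H H →ₗ[ℂ] Z)
    (hιiso : ∀ u, ‖ι u‖ = projNorm u) (hιdense : DenseRange ι)
    (T : Z →L[ℂ] Z)
    (hT : ∀ u : TensorProduct ℂ H H,
      T (ι u) = ι (TensorProduct.map A.toLinearMap B.toLinearMap u))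
    (n : ℕ) (τ : ℝ) (hτ : 0 < τ)
    (hcard : ∀ G : Finset (ℕ × ℕ), (∀ p ∈ G, τ < sSeq A p.1 * sSeq B p.2) → G.card ≤ n) :
    approxNum T (n + 1) ≤ 6.75 * τ := by
  classical
  obtain ⟨ω, hω⟩ : ∃ ω : ℝ, ω = 2 / 3 := ⟨_, rfl⟩
  have h0 : 0 < ω := by rw [hω]; norm_num
  have h1 : ω < 1 := by rw [hω]; norm_num
  obtain ⟨α, hα⟩ : ∃ α : ℝ, α = ‖A‖ + 1 := ⟨_, rfl⟩
  obtain ⟨β, hβ⟩ : ∃ β : ℝ, β = ‖B‖ + 1 := ⟨_, rfl⟩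
  have hα0 : 0 < α := by rw [hα]; positivity
  have hβ0 : 0 < β := by rw [hβ]; positivity
  have hex : ∃ N : ℕ, α * β * ω ^ (N + 2) ≤ τ := by
    obtain ⟨N, hN⟩ := exists_pow_lt_of_lt_one (show 0 < τ / (α * β) by positivity) h1
    refine ⟨N, ?_⟩
    rw [lt_div_iff₀ (by positivity)] at hN
    have : ω ^ (N + 2) ≤ ω ^ N := pow_le_pow_of_le_one h0.le h1.le (by omega)
    have := mul_le_mul_of_nonneg_left this (show 0 ≤ α * β by positivity)
    linarith
  obtain ⟨N, hN1, hN2⟩ : ∃ N : ℕ, α * β * ω ^ (N + 2) ≤ τ ∧ (0 < N → τ < α * β * ω ^ (N + 1)) := by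
    refine ⟨Nat.find hex, Nat.find_spec hex, ?_⟩
    intro hpos
    have := Nat.find_min hex (m := Nat.find hex - 1) (by omega)
    have h2 : Nat.find hex - 1 + 2 = Nat.find hex + 1 := by omega
    rw [h2] at this
    exact not_le.1 this
  obtain ⟨Ak, f, I, hAs, hAz, hAI, hAf⟩ := blocks A hA α ω (by rw [hα]; linarith) hα0 h0 h1 N
  obtain ⟨Bl, g, J, hBs, hBz, hBJ, hBg⟩ := blocks B hB β ω (by rw [hβ]; linarith) hβ0 h0 h1 N
  let F₀ : TensorProduct ℂ H H →ₗ[ℂ] TensorProduct ℂ H H :=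
    ∑ k ∈ Finset.range (N + 1), ∑ l ∈ Finset.range (N + 1),
      if k + l < N then TensorProduct.map (Ak k).toLinearMap (Bl l).toLinearMap else 0
  have hF₀ : ∀ u, F₀ u = ∑ k ∈ Finset.range (N + 1), ∑ l ∈ Finset.range (N + 1),
      if k + l < N then TensorProduct.map (Ak k).toLinearMap (Bl l).toLinearMap u else 0 := by
    intro u
    simp only [F₀, LinearMap.sum_apply]
    apply Finset.sum_congr rfl
    intro k _
    apply Finset.sum_congr rfl
    intro l _
    split_ifs <;> rfl
  have hmapn : ∀ (X Y : H →L[ℂ] H) u, ‖ι (TensorProduct.map X.toLinearMap Y.toLinearMap u)‖ ≤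
      ‖X‖ * ‖Y‖ * ‖ι u‖ := by
    intro X Y u
    rw [hιiso, hιiso]
    exact projNorm_map_le X Y u
  have hbdd : ∃ C, ∀ u, ‖(ι ∘ₗ F₀) u‖ ≤ C * ‖ι u‖ := by
    refine ⟨∑ k ∈ Finset.range (N + 1), ∑ l ∈ Finset.range (N + 1), ‖Ak k‖ * ‖Bl l‖, ?_⟩
    intro u
    rw [LinearMap.comp_apply, hF₀, map_sum, Finset.sum_mul]
    refine (norm_sum_le _ _).trans (Finset.sum_le_sum fun k _ => ?_)
    rw [map_sum, Finset.sum_mul]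
    refine (norm_sum_le _ _).trans (Finset.sum_le_sum fun l _ => ?_)
    split_ifs
    · exact hmapn _ _ u
    · rw [map_zero, norm_zero]; positivity
  let F : Z →L[ℂ] Z := (ι ∘ₗ F₀).extendOfNorm ι
  have hFι : ∀ u, F (ι u) = ι (F₀ u) := fun u => LinearMap.extendOfNorm_eq hιdense hbdd u
  have hdiff : ∀ u, (T - F) (ι u) = ∑ k ∈ Finset.range (N + 1), ∑ l ∈ Finset.range (N + 1),
      (if k + l < N then 0 else ι (TensorProduct.map (Ak k).toLinearMap (Bl l).toLinearMap u)) := by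
    intro u
    have h2 := map_sum_sum (N + 1) (fun _ => 1) Ak Bl u
    simp only [one_smul, mul_one] at h2
    rw [← hAs, ← hBs] at h2
    rw [_root_.sub_apply, hT, hFι, hF₀, h2]
    simp only [map_sum]
    rw [← Finset.sum_sub_distrib]
    apply Finset.sum_congr rfl
    intro k _
    rw [← Finset.sum_sub_distrib]
    apply Finset.sum_congr rfl
    intro l _
    split_ifs <;> simp
  have hbound : ∀ u, ‖(T - F) (ι u)‖ ≤ 6.75 * τ * ‖ι u‖ := by
    intro u
    rw [hdiff]
    refine (tail_bound N (fun k l => ι (TensorProduct.map (Ak k).toLinearMap (Bl l).toLinearMap u))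
      (α * β * ‖ι u‖) ω h0 h1 (by positivity) ?_).trans ?_
    · intro z hz
      have h2 := map_sum_sum (N + 1) (fun k => (z * (ω : ℂ)⁻¹) ^ k) Ak Bl u
      have h3 := congrArg ι h2
      simp only [map_sum, map_smul] at h3
      rw [← h3]
      refine (hmapn _ _ u).trans ?_
      have h4 := hAz z hz
      have h5 := hBz z hz
      gcongr
    · have h2 : α * β * (ω ^ N / (1 - ω)) ≤ 6.75 * τ := by
        have h3 : ω ^ N / (1 - ω) = 6.75 * ω ^ (N + 2) := by
          rw [pow_add, hω]; norm_num; ring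
        rw [h3]
        linarith
      calc α * β * ‖ι u‖ * (ω ^ N / (1 - ω)) = α * β * (ω ^ N / (1 - ω)) * ‖ι u‖ := by ring
        _ ≤ _ := by gcongr
  have hnorm : ‖T - F‖ ≤ 6.75 * τ := by
    refine ContinuousLinearMap.opNorm_le_bound _ (by positivity) ?_
    intro x
    refine hιdense.induction_on (p := fun x => ‖(T - F) x‖ ≤ 6.75 * τ * ‖x‖) x ?_ hbound
    exact isClosed_le (by fun_prop) (by fun_prop)
  let S : Finset (ℕ × ℕ) := (((Finset.range (N + 1)) ×ˢ (Finset.range (N + 1))).filter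
    (fun q => q.1 + q.2 < N)).biUnion (fun q => I q.1 ×ˢ J q.2)
  have hS : S.card ≤ n := by
    apply hcard
    intro p hp
    simp only [S, Finset.mem_biUnion, Finset.mem_filter, Finset.mem_product] at hp
    obtain ⟨q, ⟨-, hq⟩, hp1, hp2⟩ := hp
    have h2 := hAI q.1 (by omega) _ hp1
    have h3 := hBJ q.2 (by omega) _ hp2
    have h4 := hN2 (by omega)
    have h5 : ω ^ (N + 1) ≤ ω ^ (q.1 + 1) * ω ^ (q.2 + 1) := by
      rw [← pow_add]
      exact pow_le_pow_of_le_one h0.le h1.le (by omega)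
    calc τ < α * β * ω ^ (N + 1) := h4
      _ ≤ α * β * (ω ^ (q.1 + 1) * ω ^ (q.2 + 1)) := by gcongr
      _ = (α * ω ^ (q.1 + 1)) * (β * ω ^ (q.2 + 1)) := by ring
      _ ≤ _ := by
        apply mul_le_mul h2.le h3.le (by positivity)
        exact le_trans (by positivity) h2.le
  let W : Submodule ℂ Z := Submodule.span ℂ
    ((S.image (fun p => ι (f p.1 ⊗ₜ[ℂ] g p.2)) : Finset Z) : Set Z)
  have hWfin : FiniteDimensional ℂ W := FiniteDimensional.span_finset ℂ _
  have hFW : ∀ x, F x ∈ W := by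
    intro x
    refine hιdense.induction_on (p := fun x => F x ∈ W) x ?_ ?_
    · exact (W.closed_of_finiteDimensional).preimage F.continuous
    · intro u
      rw [hFι, hF₀]
      induction u using TensorProduct.induction_on with
      | zero => simp
      | add u v hu hv =>
        have : ∀ k l, (if k + l < N then
            (TensorProduct.map (Ak k).toLinearMap (Bl l).toLinearMap) (u + v) else 0) =
            (if k + l < N then (TensorProduct.map (Ak k).toLinearMap (Bl l).toLinearMap) u else 0) +
            (if k + l < N then (TensorProduct.map (Ak k).toLinearMap (Bl l).toLinearMap) v else 0) := by
          intro k l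
          split_ifs <;> simp
        simp only [this, Finset.sum_add_distrib]
        rw [map_add]
        exact W.add_mem hu hv
      | tmul x y =>
        rw [map_sum]
        refine Submodule.sum_mem _ fun k hk => ?_
        rw [map_sum]
        refine Submodule.sum_mem _ fun l hl => ?_
        split_ifs with hkl
        · rw [TensorProduct.map_tmul]
          have hx := hAf k (by omega) x
          have hy := hBg l (by omega) y
          simp only [ContinuousLinearMap.coe_coe]
          generalize Ak k x = a at hx
          generalize Bl l y = b at hy
          induction hx using Submodule.span_induction with
          | zero => simp
          | add a a' _ _ h h' => rw [TensorProduct.add_tmul, map_add]; exact W.add_mem h h'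
          | smul c a _ h => rw [← TensorProduct.smul_tmul', map_smul]; exact W.smul_mem _ h
          | mem a ha =>
            obtain ⟨i, hi, rfl⟩ := ha
            induction hy using Submodule.span_induction with
            | zero => simp
            | add a a' _ _ h h' => rw [TensorProduct.tmul_add, map_add]; exact W.add_mem h h'
            | smul c a _ h => rw [TensorProduct.tmul_smul, map_smul]; exact W.smul_mem _ h
            | mem b hb =>
              obtain ⟨j, hj, rfl⟩ := hb
              apply Submodule.subset_span
              rw [Finset.coe_image]
              refine ⟨(i, j), ?_, rfl⟩
              simp only [S, Finset.coe_biUnion, Set.mem_iUnion, Finset.mem_coe, Finset.mem_product,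
                Finset.mem_filter]
              exact ⟨(k, l), ⟨⟨hk, hl⟩, hkl⟩, hi, hj⟩
        · simp
  have hrank : LinearMap.rank (F : Z →ₗ[ℂ] Z) < ((n + 1 : ℕ) : Cardinal) := by
    have h2 : LinearMap.range (F : Z →ₗ[ℂ] Z) ≤ W := by
      rintro _ ⟨x, rfl⟩
      exact hFW x
    have h3 := Submodule.rank_mono h2
    have h4 : Module.rank ℂ W ≤ ((S.image (fun p => ι (f p.1 ⊗ₜ[ℂ] g p.2))).card : Cardinal) :=
      rank_span_finset_le _
    have h5 : (S.image (fun p => ι (f p.1 ⊗ₜ[ℂ] g p.2))).card < n + 1 :=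
      lt_of_le_of_lt (Finset.card_image_le.trans hS) (Nat.lt_succ_self n)
    exact (h3.trans h4).trans_lt (by exact_mod_cast h5)
  unfold approxNum
  refine le_trans (csInf_le ?_ (Set.mem_setOf_eq ▸ ⟨F, hrank, rfl⟩)) hnorm
  refine ⟨0, ?_⟩
  rintro _ ⟨G, -, rfl⟩
  exact norm_nonneg _

end aux5

section aux6

lemma approxNum_nonneg {X Y : Type*} [NormedAddCommGroup X] [NormedSpace ℂ X]
    [NormedAddCommGroup Y] [NormedSpace ℂ Y] (T : X →L[ℂ] Y) (n : ℕ) : 0 ≤ approxNum T n := by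
  apply Real.sInf_nonneg
  rintro _ ⟨F, -, rfl⟩
  exact norm_nonneg _

lemma sSeq_le_norm {X Y : Type*} [NormedAddCommGroup X] [NormedSpace ℂ X]
    [NormedAddCommGroup Y] [NormedSpace ℂ Y] (T : X →L[ℂ] Y) (n : ℕ) : sSeq T n ≤ ‖T‖ := by
  apply csInf_le
  · refine ⟨0, ?_⟩
    rintro _ ⟨G, -, rfl⟩
    exact norm_nonneg _
  · refine ⟨0, ?_, by simp⟩
    have : ((0 : X →L[ℂ] Y) : X →ₗ[ℂ] Y) = 0 := rfl
    rw [this, LinearMap.rank_zero]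
    exact_mod_cast Nat.succ_pos _

lemma le_tensorSeq (α β : ℕ → ℂ) (a b : ℝ) (ha : ∀ i, ‖α i‖ ≤ a) (hb : ∀ i, ‖β i‖ ≤ b) (n : ℕ) (t : ℝ)
    (h : ∀ F : Finset (ℕ × ℕ), F.card = n → ∃ p, p ∉ F ∧ t ≤ ‖α p.1‖ * ‖β p.2‖) :
    t ≤ tensorSeq α β n := by
  classical
  unfold tensorSeq
  rw [le_sub_iff_add_le, add_comm, ← le_sub_iff_add_le]
  apply csSup_le
  · obtain ⟨F, hF⟩ := Infinite.exists_subset_card_eq (ℕ × ℕ) n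
    exact ⟨_, F, hF, rfl⟩
  · rintro _ ⟨F, hF, rfl⟩
    obtain ⟨p, hp, hpt⟩ := h F hF
    have h1 : ∑ q ∈ insert p F, ‖α q.1‖ * ‖β q.2‖ ≤ tensorSum α β (n + 1) := by
      apply le_csSup
      · refine ⟨(n + 1) * (a * b), ?_⟩
        rintro _ ⟨G, hG, rfl⟩
        have hG : G.card = n + 1 := hG
        have h2 : ∀ q ∈ G, ‖α q.1‖ * ‖β q.2‖ ≤ a * b := fun q _ =>
          mul_le_mul (ha _) (hb _) (norm_nonneg _) ((norm_nonneg _).trans (ha 0))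
        refine (Finset.sum_le_sum h2).trans ?_
        simp [hG]
      · refine ⟨insert p F, ?_, rfl⟩
        have hF : F.card = n := hF
        simp [Finset.card_insert_of_notMem hp, hF]
    rw [Finset.sum_insert hp] at h1
    simp only
    linarith

end aux6

/-- Let `A, B` be compact operators on a Hilbert space `H` and let
`T = A ⊗̂ B` be the continuous linear extension of `A ⊗ B` to the projective tensor
product `H ⊗̂_π H` (realised as a Banach space `Z` together with a linear map
`ι : H ⊗ H → Z` which is isometric for the projective norm and has dense range).
Then `aₙ(A ⊗̂ B) ≤ 6.75 (s(A)⊗s(B))ₙ` for every `n ≥ 1`. -/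
theorem approxNum_projTensor_le {H Z : Type*}
    [NormedAddCommGroup H] [InnerProductSpace ℂ H] [CompleteSpace H]
    [NormedAddCommGroup Z] [NormedSpace ℂ Z] [CompleteSpace Z]
    (A B : H →L[ℂ] H) (hA : IsCompactOperator ⇑A) (hB : IsCompactOperator ⇑B)
    (ι : TensorProduct ℂ H H →ₗ[ℂ] Z)
    (hιiso : ∀ u, ‖ι u‖ = projNorm u) (hιdense : DenseRange ι)
    (T : Z →L[ℂ] Z)
    (hT : ∀ u : TensorProduct ℂ H H,
      T (ι u) = ι (TensorProduct.map A.toLinearMap B.toLinearMap u)) :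
    ∀ n : ℕ, approxNum T (n + 1) ≤ 6.75 * tensorSeq (toC (sSeq A)) (toC (sSeq B)) n := by
  intro n
  have hsa : ∀ i, ‖toC (sSeq A) i‖ = sSeq A i := fun i => by
    rw [toC, Complex.norm_real]
    exact Real.norm_of_nonneg (approxNum_nonneg A _)
  have hsb : ∀ i, ‖toC (sSeq B) i‖ = sSeq B i := fun i => by
    rw [toC, Complex.norm_real]
    exact Real.norm_of_nonneg (approxNum_nonneg B _)
  have hle := le_tensorSeq (toC (sSeq A)) (toC (sSeq B)) ‖A‖ ‖B‖
    (fun i => by rw [hsa]; exact sSeq_le_norm A i) (fun i => by rw [hsb]; exact sSeq_le_norm B i) n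
  have hnn : 0 ≤ tensorSeq (toC (sSeq A)) (toC (sSeq B)) n := by
    apply hle
    intro F _
    obtain ⟨p, hp⟩ := Infinite.exists_notMem_finset F
    exact ⟨p, hp, by positivity⟩
  have hmain : ∀ τ, tensorSeq (toC (sSeq A)) (toC (sSeq B)) n < τ →
      approxNum T (n + 1) ≤ 6.75 * τ := by
    intro τ hτ
    refine key_bound A B hA hB ι hιiso hιdense T hT n τ (hnn.trans_lt hτ) ?_
    intro G hG
    by_contra hcon
    push Not at hcon
    refine absurd (hle τ ?_) (not_le.2 hτ)
    intro F hF
    obtain ⟨p, hpG, hpF⟩ := Finset.exists_mem_notMem_of_card_lt_card (hF.trans_lt hcon)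
    refine ⟨p, hpF, ?_⟩
    rw [hsa, hsb]
    exact (hG p hpG).le
  refine le_of_forall_pos_le_add fun ε hε => ?_
  have := hmain (tensorSeq (toC (sSeq A)) (toC (sSeq B)) n + ε / 6.75)
    (by have : 0 < ε / 6.75 := by positivity
        linarith)
  refine this.trans (le_of_eq ?_)
  ring
end
end

section
/- Let H be a separable infinite-dimensional Hilbert space, 𝔦 a stable Calkin space, and Φ an elementary operator on B(H). Then the following are equivalent: (i) the sequence (hₙ(Φ))_{n≥1} of Hilbert numbers of Φ belongs to 𝔦; (ii) the sequence (aₙ(Φ))_{n≥1} of approximation numbers of Φ belongs to 𝔦; (iii) there exist m ∈ ℕ and compact operators A₁,…,Aₘ, B₁,…,Bₘ ∈ B(H) with Φ = Σ_{i=1}^m M_{A_i,B_i} and s(A_i), s(B_i) ∈ 𝔦 for every i = 1,…,m. (Since hₙ(Φ) ≤ sₙ(Φ) ≤ aₙ(Φ) for every s-number function s, these are also equivalent to s(Φ) ∈ 𝔦 for any s-number function.) -/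
open scoped BigOperators

noncomputable section

namespace ElemOp

/-! ### Sequences -/

lemma bdd_c0 {α : ℕ → ℂ} (h : α ∈ c0) : ∃ C : ℝ, ∀ n, ‖α n‖ ≤ C := by
  have h1 : Filter.Tendsto α Filter.atTop (nhds 0) := h
  obtain ⟨C, hC⟩ := (Metric.isBounded_range_of_tendsto α h1).exists_norm_le
  exact ⟨C, fun n => hC _ ⟨n, rfl⟩⟩

/-- generic sup of sums over finsets of fixed cardinality -/
def gSum {ι : Type*} (f : ι → ℝ) (n : ℕ) : ℝ :=
  sSup ((fun F : Finset ι => ∑ i ∈ F, f i) '' {F | F.card = n})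

lemma gSum_bdd {ι : Type*} {f : ι → ℝ} {C : ℝ} (hC : ∀ i, f i ≤ C) (n : ℕ) :
    BddAbove ((fun F : Finset ι => ∑ i ∈ F, f i) '' {F | F.card = n}) := by
  refine ⟨n * C, ?_⟩
  rintro _ ⟨F, hF, rfl⟩
  have hF' : F.card = n := hF
  have := Finset.sum_le_card_nsmul F f C (fun i _ => hC i)
  rw [hF'] at this
  simpa using this

lemma gSum_lower {ι : Type*} {f : ι → ℝ} {C c : ℝ} (hC : ∀ i, f i ≤ C) (n : ℕ)
    (S : Finset ι) (hS : n + 1 ≤ S.card) (hc : ∀ i ∈ S, c ≤ f i) :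
    c ≤ gSum f (n + 1) - gSum f n := by
  classical
  have : gSum f n ≤ gSum f (n + 1) - c := by
    obtain ⟨S', hS', hcard⟩ := Finset.exists_subset_card_eq (show n ≤ S.card by omega)
    refine csSup_le (Set.Nonempty.image _ ⟨S', hcard⟩) ?_
    rintro _ ⟨F, hF, rfl⟩
    have hF' : F.card = n := hF
    obtain ⟨p, hpS, hpF⟩ := Finset.exists_mem_notMem_of_card_lt_card (show F.card < S.card by omega)
    have h1 : ∑ i ∈ insert p F, f i ≤ gSum f (n + 1) :=
      le_csSup (gSum_bdd hC _) ⟨insert p F, by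
        simp [Finset.card_insert_of_notMem hpF, hF'], rfl⟩
    rw [Finset.sum_insert hpF] at h1
    have := hc p hpS
    simp only
    linarith
  linarith

lemma gSum_upper {ι : Type*} [Infinite ι] {f : ι → ℝ} {C c : ℝ} (hC : ∀ i, f i ≤ C) (n : ℕ)
    (S : Finset ι) (hS : S.card ≤ n) (hc : ∀ i, i ∉ S → f i ≤ c) :
    gSum f (n + 1) - gSum f n ≤ c := by
  classical
  have : gSum f (n + 1) ≤ gSum f n + c := by
    obtain ⟨S', hcard⟩ := Infinite.exists_subset_card_eq ι (n + 1)
    refine csSup_le (Set.Nonempty.image _ ⟨S', hcard⟩) ?_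
    rintro _ ⟨F, hF, rfl⟩
    have hF' : F.card = n + 1 := hF
    obtain ⟨p, hpF, hpS⟩ := Finset.exists_mem_notMem_of_card_lt_card (show S.card < F.card by omega)
    have h1 : ∑ i ∈ F.erase p, f i ≤ gSum f n :=
      le_csSup (gSum_bdd hC _) ⟨F.erase p, by
        simp [Finset.card_erase_of_mem hpF, hF'], rfl⟩
    have h2 := Finset.add_sum_erase F f hpF
    have := hc p hpS
    simp only
    linarith
  linarith

lemma rearr_eq (α : ℕ → ℂ) (n : ℕ) :
    rearr α n = gSum (fun i => ‖α i‖) (n + 1) - gSum (fun i => ‖α i‖) n := rfl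

lemma tensorSeq_eq (α β : ℕ → ℂ) (n : ℕ) :
    tensorSeq α β n = gSum (fun p : ℕ × ℕ => ‖α p.1‖ * ‖β p.2‖) (n + 1)
      - gSum (fun p : ℕ × ℕ => ‖α p.1‖ * ‖β p.2‖) n := rfl

lemma rearr_antitone {b : ℕ → ℝ} (hb : Antitone b) (h0 : ∀ n, 0 ≤ b n) (n : ℕ) :
    rearr (toC b) n = b n := by
  have hn : ∀ i, ‖toC b i‖ = b i := fun i => by simp [toC, abs_of_nonneg (h0 i)]
  rw [rearr_eq]
  apply le_antisymm
  · refine gSum_upper (C := b 0) (fun i => ?_) n (Finset.range n) (by simp) (fun i hi => ?_)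
    · rw [hn]; exact hb (Nat.zero_le _)
    · rw [hn]; exact hb (by simpa using hi)
  · refine gSum_lower (C := b 0) (fun i => ?_) n (Finset.range (n + 1)) (by simp) (fun i hi => ?_)
    · rw [hn]; exact hb (Nat.zero_le _)
    · rw [hn]; exact hb (by simp at hi; omega)

lemma calkin_dom {I : Set (ℕ → ℂ)} (hI : IsCalkinSpace I) {α : ℕ → ℂ} (hα : α ∈ I)
    {b : ℕ → ℝ} (hb : Antitone b) (h0 : ∀ n, 0 ≤ b n) (C : ℝ) (h : ∀ n, b n ≤ C * ‖α n‖) :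
    toC b ∈ I := by
  obtain ⟨h1, h2, h3, h4, h5⟩ := hI
  have hαC := h4 (C : ℂ) α hα
  have hc0 : Filter.Tendsto ((C : ℂ) • α) Filter.atTop (nhds 0) := h1 hαC
  have hle : ∀ n, b n ≤ ‖((C : ℂ) • α) n‖ := fun n => by
    simp only [Pi.smul_apply, norm_smul, Complex.norm_real, Real.norm_eq_abs]
    exact (h n).trans (by gcongr; exact le_abs_self C)
  refine h5 _ hαC _ ?_ (fun n => ?_)
  · have : Filter.Tendsto b Filter.atTop (nhds 0) :=
      squeeze_zero h0 hle (by simpa using hc0.norm)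
    have h6 := (Complex.continuous_ofReal.tendsto 0).comp this
    rw [Complex.ofReal_zero] at h6
    exact h6
  · rw [rearr_antitone hb h0, rearr_eq]
    obtain ⟨D, hD⟩ := bdd_c0 (h1 hαC)
    refine gSum_lower hD n (Finset.range (n + 1)) (by simp) (fun i hi => ?_)
    exact (hb (by simp at hi; omega)).trans (hle i)

lemma calkin_double {I : Set (ℕ → ℂ)} (hI : IsCalkinSpace I)
    {b : ℕ → ℝ} (hb : Antitone b) (h0 : ∀ n, 0 ≤ b n) (h : toC b ∈ I) :
    toC (fun n => b (n / 2)) ∈ I := by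
  obtain ⟨h1, h2, h3, h4, h5⟩ := hI
  have ht : Filter.Tendsto b Filter.atTop (nhds 0) := by
    have : Filter.Tendsto (toC b) Filter.atTop (nhds 0) := h1 h
    have := (Complex.continuous_re.tendsto 0).comp this
    simpa [toC, Function.comp_def] using this
  have ht2 : Filter.Tendsto (fun n => b (n / 2)) Filter.atTop (nhds 0) :=
    ht.comp (Nat.tendsto_div_const_atTop (by norm_num))
  have key : ∀ r < 2, toC (fun n => if n % 2 = r then b (n / 2) else 0) ∈ I := by
    intro r hr
    have hn : ∀ i, ‖toC (fun n => if n % 2 = r then b (n / 2) else 0) i‖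
        = if i % 2 = r then b (i / 2) else 0 := fun i => by
      simp only [toC, Complex.norm_real, Real.norm_eq_abs]
      apply abs_of_nonneg; split_ifs <;> simp [h0]
    refine h5 _ h _ ?_ (fun n => ?_)
    · show Filter.Tendsto _ _ _
      rw [tendsto_zero_iff_norm_tendsto_zero]
      simp_rw [hn]
      refine squeeze_zero (fun n => ?_) (fun n => ?_) ht2
      · split_ifs <;> simp [h0]
      · split_ifs <;> simp [h0]
    · rw [rearr_antitone hb h0, rearr_eq]
      refine gSum_upper (C := b 0) (fun i => ?_) n ((Finset.range n).image (fun j => 2 * j + r))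
        (Finset.card_image_le.trans (by simp)) (fun i hi => ?_)
      · rw [hn]; split_ifs
        · exact hb (Nat.zero_le _)
        · exact h0 0
      · rw [hn]; split_ifs with hir
        · apply hb
          by_contra hlt
          apply hi
          simp only [Finset.mem_image, Finset.mem_range]
          exact ⟨i / 2, by omega, by omega⟩
        · exact h0 n
  have := h3 _ (key 0 (by norm_num)) _ (key 1 (by norm_num))
  convert this using 1
  funext n
  rcases Nat.mod_two_eq_zero_or_one n with hn | hn <;> simp [toC, hn]

end ElemOp

namespace ElemOp

/-! ### Approximation numbers -/
section approx
variable {X Y : Type*} [NormedAddCommGroup X] [NormedSpace ℂ X]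
    [NormedAddCommGroup Y] [NormedSpace ℂ Y]

lemma an_bdd (T : X →L[ℂ] Y) (n : ℕ) : BddBelow {c | ∃ F : X →L[ℂ] Y,
    LinearMap.rank (F : X →ₗ[ℂ] Y) < (n : Cardinal) ∧ c = ‖T - F‖} :=
  ⟨0, by rintro _ ⟨F, _, rfl⟩; exact norm_nonneg _⟩

lemma an_nonempty (T : X →L[ℂ] Y) (n : ℕ) : {c | ∃ F : X →L[ℂ] Y,
    LinearMap.rank (F : X →ₗ[ℂ] Y) < ((n + 1 : ℕ) : Cardinal) ∧ c = ‖T - F‖}.Nonempty :=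
  ⟨‖T - 0‖, 0, by
    rw [ContinuousLinearMap.toLinearMap_zero, LinearMap.rank_zero]; exact_mod_cast Nat.succ_pos n, rfl⟩

lemma rank_lt_iff (F : X →L[ℂ] Y) (n : ℕ) :
    LinearMap.rank (F : X →ₗ[ℂ] Y) < ((n + 1 : ℕ) : Cardinal) ↔
    LinearMap.rank (F : X →ₗ[ℂ] Y) ≤ (n : Cardinal) := by
  rw [← Nat.succ_eq_add_one, Cardinal.nat_succ, Order.lt_succ_iff]

lemma an_le (T F : X →L[ℂ] Y) (n : ℕ) (h : LinearMap.rank (F : X →ₗ[ℂ] Y) ≤ (n : Cardinal)) :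
    approxNum T (n + 1) ≤ ‖T - F‖ :=
  csInf_le (an_bdd _ _) ⟨F, (rank_lt_iff F n).2 h, rfl⟩

lemma an_exists (T : X →L[ℂ] Y) (n : ℕ) (ε : ℝ) (hε : 0 < ε) :
    ∃ F : X →L[ℂ] Y, LinearMap.rank (F : X →ₗ[ℂ] Y) ≤ (n : Cardinal) ∧
      ‖T - F‖ < approxNum T (n + 1) + ε := by
  obtain ⟨_, ⟨F, hF, rfl⟩, h⟩ := Real.lt_sInf_add_pos (an_nonempty T n) hε
  exact ⟨F, (rank_lt_iff F n).1 hF, h⟩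

lemma an_nonneg (T : X →L[ℂ] Y) (n : ℕ) : 0 ≤ approxNum T n :=
  Real.sInf_nonneg (by rintro _ ⟨F, _, rfl⟩; exact norm_nonneg _)

lemma an_le_norm (T : X →L[ℂ] Y) (n : ℕ) : approxNum T (n + 1) ≤ ‖T‖ := by
  have := an_le T 0 n (by
    rw [ContinuousLinearMap.toLinearMap_zero, LinearMap.rank_zero]; exact zero_le)
  simpa using this

lemma le_an (T : X →L[ℂ] Y) (n : ℕ) (c : ℝ)
    (h : ∀ F : X →L[ℂ] Y, LinearMap.rank (F : X →ₗ[ℂ] Y) ≤ (n : Cardinal) → c ≤ ‖T - F‖) :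
    c ≤ approxNum T (n + 1) :=
  le_csInf (an_nonempty T n) (by rintro _ ⟨F, hF, rfl⟩; exact h F ((rank_lt_iff F n).1 hF))

lemma an_antitone (T : X →L[ℂ] Y) : Antitone (fun n => approxNum T (n + 1)) := by
  intro m n hmn
  exact le_an T m _ fun F hF => an_le T F n (hF.trans (by exact_mod_cast hmn))

lemma an_add (S T : X →L[ℂ] Y) (n : ℕ) :
    approxNum (S + T) (n + 1) ≤ approxNum S (n / 2 + 1) + approxNum T (n / 2 + 1) := by
  refine le_of_forall_pos_le_add fun ε hε => ?_
  obtain ⟨F, hF, hF'⟩ := an_exists S (n / 2) (ε / 2) (by positivity)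
  obtain ⟨G, hG, hG'⟩ := an_exists T (n / 2) (ε / 2) (by positivity)
  have h1 : LinearMap.rank ((F + G : X →L[ℂ] Y) : X →ₗ[ℂ] Y) ≤ (n : Cardinal) := by
    refine (LinearMap.rank_add_le (F : X →ₗ[ℂ] Y) (G : X →ₗ[ℂ] Y)).trans ((add_le_add hF hG).trans ?_)
    exact_mod_cast (show n / 2 + n / 2 ≤ n by omega)
  have h2 := an_le (S + T) (F + G) n h1
  have h3 : ‖S + T - (F + G)‖ ≤ ‖S - F‖ + ‖T - G‖ := by
    rw [add_sub_add_comm]; exact norm_add_le _ _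
  linarith

lemma rank_smul_le (c : ℂ) (F : X →L[ℂ] Y) :
    LinearMap.rank ((c • F : X →L[ℂ] Y) : X →ₗ[ℂ] Y) ≤ LinearMap.rank (F : X →ₗ[ℂ] Y) := by
  have : ((c • F : X →L[ℂ] Y) : X →ₗ[ℂ] Y) = (F : X →ₗ[ℂ] Y).comp (c • LinearMap.id) := by
    ext x; simp
  rw [this]
  exact LinearMap.rank_comp_le_left _ _

lemma an_smul (c : ℂ) (T : X →L[ℂ] Y) (n : ℕ) :
    approxNum (c • T) (n + 1) ≤ ‖c‖ * approxNum T (n + 1) := by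
  refine le_of_forall_pos_le_add fun ε hε => ?_
  obtain ⟨F, hF, hF'⟩ := an_exists T n (ε / (‖c‖ + 1)) (by positivity)
  have h2 := an_le (c • T) (c • F) n ((rank_smul_le c F).trans hF)
  rw [← smul_sub, norm_smul] at h2
  have h3 : ‖c‖ * (ε / (‖c‖ + 1)) ≤ ε := by
    rw [mul_div_assoc', div_le_iff₀ (by positivity)]; nlinarith [norm_nonneg c]
  nlinarith [norm_nonneg c, mul_le_mul_of_nonneg_left hF'.le (norm_nonneg c)]

lemma an_zero (n : ℕ) : approxNum (0 : X →L[ℂ] Y) (n + 1) = 0 :=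
  le_antisymm (by simpa using an_le_norm (0 : X →L[ℂ] Y) n) (an_nonneg _ _)

/-- operators with s-numbers in `I` form a subspace -/
def sIdeal (X Y : Type*) [NormedAddCommGroup X] [NormedSpace ℂ X]
    [NormedAddCommGroup Y] [NormedSpace ℂ Y] {I : Set (ℕ → ℂ)} (hI : IsCalkinSpace I) :
    Submodule ℂ (X →L[ℂ] Y) where
  carrier := {T | toC (fun n => approxNum T (n + 1)) ∈ I}
  zero_mem' := by
    have : toC (fun n => approxNum (0 : X →L[ℂ] Y) (n + 1)) = 0 := by
      funext n; simp [toC, an_zero]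
    show _ ∈ I
    rw [this]; exact hI.2.1
  add_mem' := by
    intro S T hS hT
    have h1 := calkin_double hI (an_antitone S) (fun n => an_nonneg _ _) hS
    have h2 := calkin_double hI (an_antitone T) (fun n => an_nonneg _ _) hT
    refine calkin_dom hI (hI.2.2.1 _ h1 _ h2) (an_antitone _) (fun n => an_nonneg _ _) 1 fun n => ?_
    have := an_add S T n
    simp only [toC, Pi.add_apply]
    rw [← Complex.ofReal_add, Complex.norm_real, Real.norm_eq_abs, one_mul]
    exact this.trans (le_abs_self _)
  smul_mem' := by
    intro c T hT
    refine calkin_dom hI hT (an_antitone _) (fun n => an_nonneg _ _) ‖c‖ fun n => ?_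
    simp only [toC]
    rw [Complex.norm_real, Real.norm_eq_abs, abs_of_nonneg (an_nonneg _ _)]
    exact an_smul c T n

lemma mem_sIdeal {I : Set (ℕ → ℂ)} (hI : IsCalkinSpace I) (T : X →L[ℂ] Y) :
    T ∈ sIdeal X Y hI ↔ toC (fun n => approxNum T (n + 1)) ∈ I := Iff.rfl

lemma an_tendsto_of_mem {I : Set (ℕ → ℂ)} (hI : IsCalkinSpace I) (T : X →L[ℂ] Y)
    (h : toC (fun n => approxNum T (n + 1)) ∈ I) :
    Filter.Tendsto (fun n => approxNum T (n + 1)) Filter.atTop (nhds 0) := by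
  have : Filter.Tendsto (toC (fun n => approxNum T (n + 1))) Filter.atTop (nhds 0) := hI.1 h
  have := (Complex.continuous_re.tendsto 0).comp this
  simpa [toC, Function.comp_def] using this

lemma finrank_compact (F : X →L[ℂ] Y) (n : ℕ)
    (h : LinearMap.rank (F : X →ₗ[ℂ] Y) ≤ (n : Cardinal)) : IsCompactOperator F := by
  have hfd : FiniteDimensional ℂ (LinearMap.range (F : X →ₗ[ℂ] Y)) :=
    Module.rank_lt_aleph0_iff.1 (lt_of_le_of_lt h (Cardinal.natCast_lt_aleph0))
  let G : X →L[ℂ] LinearMap.range (F : X →ₗ[ℂ] Y) := F.codRestrict _ (fun x => ⟨x, rfl⟩)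
  have : LocallyCompactSpace (LinearMap.range (F : X →ₗ[ℂ] Y)) := by
    have := FiniteDimensional.proper ℂ (LinearMap.range (F : X →ₗ[ℂ] Y))
    infer_instance
  have hG : IsCompactOperator G := isCompactOperator_of_locallyCompactSpace_dom G
  exact hG.clm_comp (LinearMap.range (F : X →ₗ[ℂ] Y)).subtypeL

lemma compact_of_tendsto [CompleteSpace Y] (T : X →L[ℂ] Y)
    (h : Filter.Tendsto (fun n => approxNum T (n + 1)) Filter.atTop (nhds 0)) :
    IsCompactOperator T := by
  choose F hF hF' using fun n : ℕ => an_exists T n (1 / ((n : ℝ) + 1)) (by positivity)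
  refine isCompactOperator_of_tendsto (l := Filter.atTop) (F := F) ?_
    (Filter.Eventually.of_forall fun n => finrank_compact _ n (hF n))
  rw [tendsto_iff_norm_sub_tendsto_zero]
  have h2 := h.add tendsto_one_div_add_atTop_nhds_zero_nat
  rw [add_zero] at h2
  refine squeeze_zero (fun n => norm_nonneg _) (fun n => ?_) h2
  rw [norm_sub_rev]; exact (hF' n).le

end approx
end ElemOp

namespace ElemOp

/-! ### Spectral blocks of compact operators -/
section spectral
variable {H : Type*} [NormedAddCommGroup H] [InnerProductSpace ℂ H]

lemma pyth {ι : Type*} (s : Finset ι) (f : ι → H)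
    (h : ∀ i ∈ s, ∀ j ∈ s, i ≠ j → inner ℂ (f i) (f j) = 0) :
    ‖∑ i ∈ s, f i‖ ^ 2 = ∑ i ∈ s, ‖f i‖ ^ 2 := by
  classical
  induction s using Finset.induction_on with
  | empty => simp
  | insert a s ha ih =>
    rw [Finset.sum_insert ha, Finset.sum_insert ha, ← ih (fun i hi j hj => h i (by simp [hi]) j (by simp [hj]))]
    have : inner ℂ (f a) (∑ i ∈ s, f i) = 0 := by
      rw [inner_sum]
      refine Finset.sum_eq_zero fun i hi => h a (by simp) i (by simp [hi]) ?_
      rintro rfl; exact ha hi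
    have := norm_add_sq_eq_norm_sq_add_norm_sq_of_inner_eq_zero _ _ this
    simpa [sq] using this

variable [CompleteSpace H]

open Module.End

def AA (A : H →L[ℂ] H) : H →ₗ[ℂ] H := ((ContinuousLinearMap.adjoint A).comp A : H →L[ℂ] H)

lemma AA_inner (A : H →L[ℂ] H) (u v : H) : inner ℂ (AA A u) v = inner ℂ (A u) (A v) := by
  simp [AA, ContinuousLinearMap.adjoint_inner_left]

lemma AA_symm (A : H →L[ℂ] H) : (AA A).IsSymmetric := by
  intro u v
  rw [AA_inner, ← inner_conj_symm u, AA_inner, inner_conj_symm]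

lemma AA_compact {A : H →L[ℂ] H} (h : IsCompactOperator A) : IsCompactOperator (AA A) :=
  h.clm_comp (ContinuousLinearMap.adjoint A)

lemma norm_A_sum (A : H →L[ℂ] H) (s : Finset ℂ) (f : ℂ → H) (hf : ∀ μ, f μ ∈ eigenspace (AA A) μ) :
    ‖A (∑ μ ∈ s, f μ)‖ ^ 2 = ∑ μ ∈ s, μ.re * ‖f μ‖ ^ 2 ∧ ‖∑ μ ∈ s, f μ‖ ^ 2 = ∑ μ ∈ s, ‖f μ‖ ^ 2 := by
  have horth : ∀ μ ν : ℂ, μ ≠ ν → inner ℂ (f μ) (f ν) = 0 := fun μ ν hne =>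
    (AA_symm A).orthogonalFamily_eigenspaces hne ⟨f μ, hf μ⟩ ⟨f ν, hf ν⟩
  have h1 : ∀ μ ν : ℂ, inner ℂ (A (f μ)) (A (f ν)) = (starRingEnd ℂ) μ * inner ℂ (f μ) (f ν) := by
    intro μ ν
    rw [← AA_inner, mem_eigenspace_iff.1 (hf μ), inner_smul_left]
  constructor
  · rw [map_sum, pyth]
    · refine Finset.sum_congr rfl fun μ _ => ?_
      have := h1 μ μ
      rw [inner_self_eq_norm_sq_to_K, inner_self_eq_norm_sq_to_K] at this
      have := congrArg Complex.re this
      norm_cast at this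
      simpa [Complex.mul_re, ← Complex.ofReal_pow] using this
    · intro μ _ ν _ hne
      rw [h1, horth μ ν hne, mul_zero]
  · exact pyth _ _ fun μ _ ν _ hne => horth μ ν hne

/-- spectral subspace for a set of eigenvalues -/
def specS (A : H →L[ℂ] H) (S : Set ℂ) : Submodule ℂ H := ⨆ μ : S, eigenspace (AA A) (μ : ℂ)

lemma specS_repr {A : H →L[ℂ] H} {S : Set ℂ} {v : H} (hv : v ∈ specS A S) :
    ∃ (s : Finset ℂ) (f : ℂ → H), (∀ μ, f μ ∈ eigenspace (AA A) μ) ∧ (∀ μ ∈ s, μ ∈ S) ∧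
      v = ∑ μ ∈ s, f μ := by
  classical
  obtain ⟨f, hf, hsum⟩ := (Submodule.mem_iSup_iff_exists_finsupp _ _).1 hv
  refine ⟨f.support.map (Function.Embedding.subtype _),
    fun μ => if h : μ ∈ S then f ⟨μ, h⟩ else 0, fun μ => ?_, ?_, ?_⟩
  · by_cases h : μ ∈ S
    · simpa [h] using hf ⟨μ, h⟩
    · simp [h]
  · intro μ hμ
    simp only [Finset.mem_map] at hμ
    obtain ⟨x, _, rfl⟩ := hμ
    exact x.2
  · rw [← hsum, Finset.sum_map, Finsupp.sum]
    refine Finset.sum_congr rfl fun x _ => ?_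
    simp

lemma specS_lower {A : H →L[ℂ] H} {S : Set ℂ} {c : ℝ} (hS : ∀ μ ∈ S, c ^ 2 ≤ μ.re)
    {v : H} (hv : v ∈ specS A S) : c * ‖v‖ ≤ ‖A v‖ := by
  obtain ⟨s, f, hf, hs, rfl⟩ := specS_repr hv
  obtain ⟨h1, h2⟩ := norm_A_sum A s f hf
  refine le_of_sq_le_sq ?_ (norm_nonneg _)
  rw [mul_pow, h1, h2, Finset.mul_sum]
  exact Finset.sum_le_sum fun μ hμ => mul_le_mul_of_nonneg_right (hS μ (hs μ hμ)) (by positivity)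

lemma specS_upper {A : H →L[ℂ] H} {S : Set ℂ} {c : ℝ} (hc : 0 ≤ c) (hS : ∀ μ ∈ S, μ.re ≤ c ^ 2)
    {v : H} (hv : v ∈ specS A S) : ‖A v‖ ≤ c * ‖v‖ := by
  obtain ⟨s, f, hf, hs, rfl⟩ := specS_repr hv
  obtain ⟨h1, h2⟩ := norm_A_sum A s f hf
  refine le_of_sq_le_sq ?_ (by positivity)
  rw [mul_pow, h1, h2, Finset.mul_sum]
  exact Finset.sum_le_sum fun μ hμ => mul_le_mul_of_nonneg_right (hS μ (hs μ hμ)) (by positivity)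

lemma specS_mono (A : H →L[ℂ] H) {S T : Set ℂ} (h : S ⊆ T) : specS A S ≤ specS A T :=
  iSup_le fun μ => le_iSup (fun μ : T => eigenspace (AA A) (μ : ℂ)) ⟨μ, h μ.2⟩

lemma specS_inv {A : H →L[ℂ] H} {S : Set ℂ} {v : H} (hv : v ∈ specS A S) : AA A v ∈ specS A S := by
  obtain ⟨s, f, hf, hs, rfl⟩ := specS_repr hv
  rw [map_sum]
  refine Submodule.sum_mem _ fun μ hμ => ?_
  rw [mem_eigenspace_iff.1 (hf μ)]
  exact Submodule.smul_mem _ _ (Submodule.mem_iSup_of_mem (⟨μ, hs μ hμ⟩ : S) (hf μ))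

lemma specS_orth {A : H →L[ℂ] H} {S T : Set ℂ} (h : Disjoint S T) {v w : H}
    (hv : v ∈ specS A S) (hw : w ∈ specS A T) : inner ℂ v w = 0 := by
  obtain ⟨s, f, hf, hs, rfl⟩ := specS_repr hv
  obtain ⟨t, g, hg, ht, rfl⟩ := specS_repr hw
  rw [sum_inner]
  refine Finset.sum_eq_zero fun μ hμ => ?_
  rw [inner_sum]
  refine Finset.sum_eq_zero fun ν hν => ?_
  have hne : μ ≠ ν := by
    rintro rfl
    exact Set.disjoint_left.1 h (hs μ hμ) (ht μ hν)
  exact (AA_symm A).orthogonalFamily_eigenspaces hne ⟨f μ, hf μ⟩ ⟨g ν, hg ν⟩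

/-- spectral subspace of `|A|` for `[c, ∞)` -/
def specV (A : H →L[ℂ] H) (c : ℝ) : Submodule ℂ H := specS A {μ | c ^ 2 ≤ μ.re}

lemma specV_rank (A : H →L[ℂ] H) (c : ℝ) (n : ℕ)
    (h : ¬ Module.rank ℂ (specV A c) ≤ (n : Cardinal)) : c ≤ approxNum A (n + 1) := by
  refine le_an A n c fun F hF => ?_
  by_contra hlt
  push Not at hlt
  apply h
  refine le_trans ?_ hF
  let g : specV A c →ₗ[ℂ] LinearMap.range (F : H →ₗ[ℂ] H) :=
    (F : H →ₗ[ℂ] H).rangeRestrict.comp (specV A c).subtype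
  refine LinearMap.rank_le_of_injective g ?_
  rw [← LinearMap.ker_eq_bot, LinearMap.ker_eq_bot']
  rintro ⟨v, hv⟩ hgv
  have hFv : F v = 0 := congrArg Subtype.val hgv
  have h1 : c * ‖v‖ ≤ ‖A v‖ := specS_lower (fun μ hμ => hμ) hv
  have h2 : ‖A v‖ ≤ ‖A - F‖ * ‖v‖ := by
    have := (A - F).le_opNorm v
    simpa [hFv] using this
  have h3 : v = 0 := by
    by_contra hv0
    have : 0 < ‖v‖ := norm_pos_iff.2 hv0
    nlinarith
  simp [h3]

lemma specV_upper {A : H →L[ℂ] H} (hA : IsCompactOperator A) {c : ℝ} (hc : 0 ≤ c)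
    [FiniteDimensional ℂ (specV A c)] {v : H} (hv : v ∈ (specV A c)ᗮ) : ‖A v‖ ≤ c * ‖v‖ := by
  set W := specS A {μ | ¬ c ^ 2 ≤ μ.re} with hW
  have hdense : (specV A c ⊔ W).topologicalClosure = ⊤ := by
    rw [Submodule.topologicalClosure_eq_top_iff, eq_bot_iff,
      ← ContinuousLinearMap.orthogonalComplement_iSup_eigenspaces_eq_bot (AA_compact hA) (AA_symm A)]
    apply Submodule.orthogonal_le
    refine iSup_le fun μ => ?_
    by_cases hμ : c ^ 2 ≤ μ.re
    · exact le_sup_of_le_left (le_iSup (fun μ : {μ : ℂ | c ^ 2 ≤ μ.re} => eigenspace (AA A) (μ : ℂ)) ⟨μ, hμ⟩)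
    · exact le_sup_of_le_right (le_iSup (fun μ : {μ : ℂ | ¬ c ^ 2 ≤ μ.re} => eigenspace (AA A) (μ : ℂ)) ⟨μ, hμ⟩)
  set P := (specV A c).starProjection
  have hcl : IsClosed {x : H | ‖A (x - P x)‖ ≤ c * ‖x - P x‖} :=
    isClosed_le (by fun_prop) (by fun_prop)
  have hsub : ((specV A c ⊔ W : Submodule ℂ H) : Set H) ⊆ {x : H | ‖A (x - P x)‖ ≤ c * ‖x - P x‖} := by
    intro x hx
    obtain ⟨y, hy, w, hw, rfl⟩ := Submodule.mem_sup.1 hx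
    have hPw : P w = 0 := by
      rw [Submodule.starProjection_apply_eq_zero_iff]
      rw [Submodule.mem_orthogonal]
      intro u hu
      refine specS_orth ?_ hu hw
      exact Set.disjoint_left.2 fun μ h1 h2 => h2 h1
    have hPy : P y = y := Submodule.starProjection_eq_self_iff.2 hy
    have : y + w - P (y + w) = w := by rw [map_add, hPw, hPy]; abel
    simp only [Set.mem_ofPred_eq, this]
    exact specS_upper hc (fun μ hμ => (not_le.1 hμ).le) hw
  have hmem : v ∈ (specV A c ⊔ W).topologicalClosure := by rw [hdense]; trivial
  have h1 := closure_minimal hsub hcl hmem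
  have hPv : P v = 0 := by rw [Submodule.starProjection_apply_eq_zero_iff]; exact hv
  simpa [hPv] using h1

lemma specV_mono (A : H →L[ℂ] H) {c d : ℝ} (hc : 0 ≤ d) (h : d ≤ c) : specV A c ≤ specV A d :=
  specS_mono A fun μ hμ => le_trans (pow_le_pow_left₀ hc h 2) hμ

lemma specV_A_orth {A : H →L[ℂ] H} {c : ℝ} {u v : H} (hu : u ∈ specV A c)
    (hv : v ∈ (specV A c)ᗮ) : inner ℂ (A u) (A v) = 0 := by
  rw [← AA_inner]
  exact (Submodule.mem_orthogonal _ _).1 hv _ (specS_inv hu)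

lemma blocks {A : H →L[ℂ] H} (hA : IsCompactOperator A)
    (ht : Filter.Tendsto (fun n => approxNum A (n + 1)) Filter.atTop (nhds 0))
    (a : ℝ) (ha : ‖A‖ < a) :
    ∃ (N : ℕ → ℕ) (E : ℕ → H →L[ℂ] H), N 0 = 0 ∧ Monotone N ∧
      (∀ k i, i < N k → a / 2 ^ k ≤ approxNum A (i + 1)) ∧
      (∀ k, LinearMap.rank ((E k : H →L[ℂ] H) : H →ₗ[ℂ] H) ≤ ((N (k + 1) - N k : ℕ) : Cardinal)) ∧
      (∀ k v, ‖A (E k v)‖ ≤ a / 2 ^ k * ‖E k v‖) ∧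
      (∀ j k u v, j ≠ k → inner ℂ (A (E j u)) (A (E k v)) = 0) ∧
      (∀ n v, ∑ k ∈ Finset.range n, ‖E k v‖ ^ 2 ≤ ‖v‖ ^ 2) ∧
      (∀ n v, ‖A (v - ∑ k ∈ Finset.range n, E k v)‖ ≤ a / 2 ^ n * ‖v‖) := by
  have ha0 : 0 < a := (norm_nonneg A).trans_lt ha
  set V : ℕ → Submodule ℂ H := fun k => specV A (a / 2 ^ k) with hV
  have hrank : ∀ k, ∃ n : ℕ, Module.rank ℂ (V k) ≤ (n : Cardinal) := by
    intro k
    obtain ⟨n, hn⟩ := (ht.eventually (gt_mem_nhds (show (0 : ℝ) < a / 2 ^ k by positivity))).exists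
    refine ⟨n, ?_⟩
    by_contra h
    exact absurd (specV_rank A _ n h) (not_le.2 hn)
  have hfd : ∀ k, FiniteDimensional ℂ (V k) := fun k => by
    obtain ⟨n, hn⟩ := hrank k
    exact Module.rank_lt_aleph0_iff.1 (lt_of_le_of_lt hn (Cardinal.natCast_lt_aleph0))
  have hmono : Monotone V := by
    intro j k hjk
    apply specV_mono A (by positivity)
    gcongr
    norm_num
  have hV0 : V 0 = ⊥ := by
    rw [eq_bot_iff]
    intro v hv
    have h1 : a / 2 ^ 0 * ‖v‖ ≤ ‖A v‖ := specS_lower (fun μ hμ => hμ) hv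
    have h2 := A.le_opNorm v
    rw [Submodule.mem_bot]
    by_contra hv0
    have : 0 < ‖v‖ := norm_pos_iff.2 hv0
    simp at h1
    nlinarith
  set P : ℕ → H →L[ℂ] H := fun k => (V k).starProjection with hP
  have hPmem : ∀ k v, P k v ∈ V k := fun k v => Submodule.starProjection_apply_mem _ _
  have hPorth : ∀ k v, v - P k v ∈ (V k)ᗮ := fun k v => Submodule.sub_starProjection_mem_orthogonal v
  set E : ℕ → H →L[ℂ] H := fun k => P (k + 1) - P k with hE
  have hEmem : ∀ k v, E k v ∈ V (k + 1) := fun k v =>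
    Submodule.sub_mem _ (hPmem _ _) (hmono (Nat.le_succ k) (hPmem _ _))
  have hEorth : ∀ k v, E k v ∈ (V k)ᗮ := fun k v => by
    have : E k v = (v - P k v) - (v - P (k + 1) v) := by simp [hE]
    rw [this]
    exact Submodule.sub_mem _ (hPorth _ _) (Submodule.orthogonal_le (hmono (Nat.le_succ k)) (hPorth _ _))
  have hPsum : ∀ n, ∀ v, ∑ k ∈ Finset.range n, E k v = P n v := by
    intro n v
    have h0 : P 0 v = 0 := by
      have := hPmem 0 v
      rwa [hV0, Submodule.mem_bot] at this
    simp only [hE, sub_apply]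
    rw [Finset.sum_range_sub (fun k => P k v), h0, sub_zero]
  refine ⟨fun k => Module.finrank ℂ (V k), E, ?_, ?_, ?_, ?_, ?_, ?_, ?_, ?_⟩
  · show Module.finrank ℂ (V 0) = 0
    rw [hV0]; simp
  · intro j k hjk
    exact Submodule.finrank_mono (hmono hjk)
  · intro k i hi
    apply specV_rank
    rw [not_le]
    exact Module.lt_rank_of_lt_finrank hi
  · intro k
    have h1 : Module.finrank ℂ ((V k)ᗮ ⊓ V (k + 1) : Submodule ℂ H)
        = Module.finrank ℂ (V (k + 1)) - Module.finrank ℂ (V k) := by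
      have := Submodule.finrank_add_inf_finrank_orthogonal (hmono (Nat.le_succ k))
      simp only [Nat.succ_eq_add_one] at this
      omega
    have h2 : LinearMap.range ((E k : H →L[ℂ] H) : H →ₗ[ℂ] H) ≤ (V k)ᗮ ⊓ V (k + 1) := by
      rintro _ ⟨v, rfl⟩
      exact ⟨hEorth k v, hEmem k v⟩
    rw [← h1]
    have : FiniteDimensional ℂ ((V k)ᗮ ⊓ V (k + 1) : Submodule ℂ H) :=
      Submodule.finiteDimensional_inf_right _ _
    rw [Module.finrank_eq_rank]
    exact Submodule.rank_mono h2
  · intro k v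
    have : FiniteDimensional ℂ (specV A (a / 2 ^ k)) := hfd k
    exact specV_upper hA (by positivity) (hEorth k v)
  · have key : ∀ j k u v, j < k → inner ℂ (A (E j u)) (A (E k v)) = 0 := by
      intro j k u v hjk
      exact specV_A_orth (hmono (Nat.succ_le_of_lt hjk) (hEmem j u)) (hEorth k v)
    intro j k u v hne
    rcases lt_or_gt_of_ne hne with h | h
    · exact key _ _ _ _ h
    · rw [← inner_conj_symm, key _ _ _ _ h, map_zero]
  · intro n v
    have key : ∀ j k, j < k → inner ℂ (E j v) (E k v) = 0 := by
      intro j k hjk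
      exact (Submodule.mem_orthogonal _ _).1 (hEorth k v) _ (hmono (Nat.succ_le_of_lt hjk) (hEmem j v))
    rw [← pyth, hPsum]
    · have : ‖P n v‖ ≤ ‖v‖ := Submodule.norm_starProjection_apply_le _ _
      gcongr
    · intro j _ k _ hne
      rcases lt_or_gt_of_ne hne with h | h
      · exact key _ _ h
      · rw [← inner_conj_symm, key _ _ h, map_zero]
  · intro n v
    rw [hPsum]
    have : FiniteDimensional ℂ (specV A (a / 2 ^ n)) := hfd n
    refine (specV_upper hA (by positivity) (hPorth n v)).trans ?_
    have h1 : ‖v - P n v‖ ≤ ‖v‖ := by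
      have h2 := norm_add_sq_eq_norm_sq_add_norm_sq_of_inner_eq_zero (P n v) (v - P n v)
        ((Submodule.mem_orthogonal _ _).1 (hPorth n v) _ (hPmem n v))
      rw [add_sub_cancel] at h2
      nlinarith [norm_nonneg v, norm_nonneg (v - P n v), norm_nonneg (P n v)]
    gcongr

end spectral
end ElemOp

namespace ElemOp

/-! ### The estimate for `M_{A,B}` -/
section mult
variable {H : Type*} [NormedAddCommGroup H] [InnerProductSpace ℂ H]

lemma Mop_apply (A B X : H →L[ℂ] H) (v : H) : Mop A B X v = A (X (B v)) := rfl

lemma Mop_norm_rank (A B : H →L[ℂ] H) (m n : ℕ)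
    (hA : LinearMap.rank (A : H →ₗ[ℂ] H) ≤ (m : Cardinal))
    (hB : LinearMap.rank (B : H →ₗ[ℂ] H) ≤ (n : Cardinal)) :
    LinearMap.rank ((Mop A B : (H →L[ℂ] H) →L[ℂ] (H →L[ℂ] H)) : (H →L[ℂ] H) →ₗ[ℂ] (H →L[ℂ] H))
      ≤ ((m * n : ℕ) : Cardinal) := by
  have hfA : FiniteDimensional ℂ (LinearMap.range (A : H →ₗ[ℂ] H)) :=
    Module.rank_lt_aleph0_iff.1 (lt_of_le_of_lt hA (Cardinal.natCast_lt_aleph0))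
  have hfB : FiniteDimensional ℂ (LinearMap.range (B : H →ₗ[ℂ] H)) :=
    Module.rank_lt_aleph0_iff.1 (lt_of_le_of_lt hB (Cardinal.natCast_lt_aleph0))
  let U := LinearMap.range (A : H →ₗ[ℂ] H)
  let W := LinearMap.range (B : H →ₗ[ℂ] H)
  -- the range embeds into `W →ₗ U`
  let g : (W →ₗ[ℂ] U) →ₗ[ℂ] (H →ₗ[ℂ] H) :=
    { toFun := fun f => U.subtype.comp (f.comp (B : H →ₗ[ℂ] H).rangeRestrict)
      map_add' := fun f f' => by ext; simp
      map_smul' := fun c f => by ext; simp }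
  let h : (H →L[ℂ] H) →ₗ[ℂ] (H →ₗ[ℂ] H) := ContinuousLinearMap.coeLM ℂ
  have hinj : Function.Injective h := fun x y hxy => ContinuousLinearMap.coe_injective hxy
  have h1 : (LinearMap.range ((Mop A B : (H →L[ℂ] H) →L[ℂ] (H →L[ℂ] H)) :
      (H →L[ℂ] H) →ₗ[ℂ] (H →L[ℂ] H))).map h ≤ LinearMap.range g := by
    rintro _ ⟨_, ⟨X, rfl⟩, rfl⟩
    refine ⟨((A : H →ₗ[ℂ] H).rangeRestrict.comp (X : H →ₗ[ℂ] H)).comp W.subtype, ?_⟩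
    ext v
    rfl
  have h2 := Submodule.rank_mono h1
  have h3 : Module.rank ℂ ((LinearMap.range ((Mop A B : (H →L[ℂ] H) →L[ℂ] (H →L[ℂ] H)) :
      (H →L[ℂ] H) →ₗ[ℂ] (H →L[ℂ] H))).map h) = _ :=
    (Submodule.equivMapOfInjective h hinj _).rank_eq.symm
  rw [h3] at h2
  refine h2.trans ((rank_range_le g).trans ?_)
  rw [← Module.finrank_eq_rank, Module.finrank_linearMap]
  have hA' : Module.finrank ℂ U ≤ m := Module.finrank_le_of_rank_le hA
  have hB' : Module.finrank ℂ W ≤ n := Module.finrank_le_of_rank_le hB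
  have : Module.finrank ℂ W * Module.finrank ℂ U ≤ m * n := by
    rw [mul_comm m n]; exact Nat.mul_le_mul hB' hA'
  exact_mod_cast this

lemma double_sum_bound (n : ℕ) (g : ℕ → ℝ) (hg : ∀ l, 0 ≤ g l) :
    ∑ k ∈ Finset.range n, (1 / 4 : ℝ) ^ k * ∑ l ∈ Finset.Ico (n - k) n, (1 / 4 : ℝ) ^ l * g l
      ≤ 4 / 3 * (1 / 4) ^ n * ∑ l ∈ Finset.range n, g l := by
  have h1 : ∀ k ∈ Finset.range n, (1 / 4 : ℝ) ^ k * ∑ l ∈ Finset.Ico (n - k) n, (1 / 4 : ℝ) ^ l * g l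
      = ∑ l ∈ Finset.range n, if n ≤ k + l then (1 / 4 : ℝ) ^ k * ((1 / 4 : ℝ) ^ l * g l) else 0 := by
    intro k _
    rw [Finset.mul_sum, ← Finset.sum_filter]
    refine Finset.sum_congr ?_ fun _ _ => rfl
    ext l
    simp only [Finset.mem_Ico, Finset.mem_filter, Finset.mem_range]
    omega
  rw [Finset.sum_congr rfl h1, Finset.sum_comm, Finset.mul_sum]
  refine Finset.sum_le_sum fun l hl => ?_
  have hl' : l < n := by simpa using hl
  rw [← Finset.sum_filter]
  have h2 : (Finset.range n).filter (fun k => n ≤ k + l) = Finset.Ico (n - l) n := by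
    ext k
    simp only [Finset.mem_Ico, Finset.mem_filter, Finset.mem_range]
    omega
  rw [h2, ← Finset.sum_mul]
  have h3 := geom_sum_Ico_le_of_lt_one (x := (1 / 4 : ℝ)) (m := n - l) (n := n) (by norm_num) (by norm_num)
  have h4 : (1 / 4 : ℝ) ^ n = (1 / 4) ^ (n - l) * (1 / 4) ^ l := by
    rw [← pow_add]; congr 1; omega
  rw [h4]
  have h5 : (1 / 4 : ℝ) ^ (n - l) / (1 - 1 / 4) = 4 / 3 * (1 / 4) ^ (n - l) := by ring
  rw [h5] at h3
  calc _ ≤ 4 / 3 * (1 / 4 : ℝ) ^ (n - l) * ((1 / 4 : ℝ) ^ l * g l) := by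
        gcongr
        exact mul_nonneg (by positivity) (hg l)
    _ = _ := by ring

lemma div_two_pow_sq (a : ℝ) (k : ℕ) : (a / 2 ^ k) ^ 2 = a ^ 2 * (1 / 4) ^ k := by
  rw [div_pow, ← pow_mul, mul_comm k 2, pow_mul, div_eq_mul_inv, one_div, inv_pow]; norm_num

lemma err_bound (A B : H →L[ℂ] H) (a b : ℝ) (ha : 0 < a) (hb : 0 < b) (E G : ℕ → H →L[ℂ] H)
    (hE1 : ∀ k v, ‖A (E k v)‖ ≤ a / 2 ^ k * ‖E k v‖)
    (hE2 : ∀ j k u v, j ≠ k → inner ℂ (A (E j u)) (A (E k v)) = 0)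
    (hE3 : ∀ n v, ∑ k ∈ Finset.range n, ‖E k v‖ ^ 2 ≤ ‖v‖ ^ 2)
    (hE4 : ∀ n v, ‖A (v - ∑ k ∈ Finset.range n, E k v)‖ ≤ a / 2 ^ n * ‖v‖)
    (hG1 : ∀ k v, ‖B (G k v)‖ ≤ b / 2 ^ k * ‖G k v‖)
    (hG2 : ∀ j k u v, j ≠ k → inner ℂ (B (G j u)) (B (G k v)) = 0)
    (hG3 : ∀ n v, ∑ k ∈ Finset.range n, ‖G k v‖ ^ 2 ≤ ‖v‖ ^ 2)
    (hG4 : ∀ n v, ‖B (v - ∑ k ∈ Finset.range n, G k v)‖ ≤ b / 2 ^ n * ‖v‖) (n : ℕ) :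
    ‖Mop A B - ∑ k ∈ Finset.range n, ∑ l ∈ Finset.range (n - k),
      Mop (A.comp (E k)) (B.comp (G l))‖ ≤ 4 * (a * b / 2 ^ n) := by
  refine ContinuousLinearMap.opNorm_le_bound _ (by positivity) fun X => ?_
  refine ContinuousLinearMap.opNorm_le_bound _ (by positivity) fun v => ?_
  have hBv : ‖B v‖ ≤ b * ‖v‖ := by simpa using hG4 0 v
  have hEle : ∀ k y, ‖E k y‖ ≤ ‖y‖ := by
    intro k y
    have h1 := hE3 (k + 1) y
    have h2 := Finset.single_le_sum (f := fun k => ‖E k y‖ ^ 2) (fun i _ => by positivity)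
      (Finset.self_mem_range_succ k)
    exact le_of_sq_le_sq (h2.trans h1) (norm_nonneg _)
  set r : ℕ → H := fun k => B (v - ∑ l ∈ Finset.range (n - k), G l v) with hr
  have hdecomp : (Mop A B - ∑ k ∈ Finset.range n, ∑ l ∈ Finset.range (n - k),
      Mop (A.comp (E k)) (B.comp (G l))) X v
      = A (X (B v) - ∑ k ∈ Finset.range n, E k (X (B v)))
        + ∑ k ∈ Finset.range n, A (E k (X (r k))) := by
    simp only [hr, sub_apply, sum_apply, Mop_apply, ContinuousLinearMap.comp_apply,
      map_sub, map_sum, Finset.sum_sub_distrib]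
    abel
  rw [hdecomp]
  have hfirst : ‖A (X (B v) - ∑ k ∈ Finset.range n, E k (X (B v)))‖ ≤ a * b / 2 ^ n * ‖X‖ * ‖v‖ := by
    refine (hE4 n _).trans ?_
    calc a / 2 ^ n * ‖X (B v)‖ ≤ a / 2 ^ n * (‖X‖ * (b * ‖v‖)) := by
          gcongr; exact (X.le_opNorm _).trans (by gcongr)
      _ = _ := by ring
  have hrk : ∀ k ∈ Finset.range n, ‖r k‖ ^ 2 ≤ 2 * b ^ 2 *
      ((∑ l ∈ Finset.Ico (n - k) n, (1 / 4 : ℝ) ^ l * ‖G l v‖ ^ 2) + (1 / 4) ^ n * ‖v‖ ^ 2) := by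
    intro k _
    have h1 : r k = (∑ l ∈ Finset.Ico (n - k) n, B (G l v)) + B (v - ∑ l ∈ Finset.range n, G l v) := by
      simp only [hr, map_sub, map_sum]
      rw [← Finset.sum_range_add_sum_Ico (fun l => B (G l v)) (Nat.sub_le n k)]
      abel
    have h2 : ‖∑ l ∈ Finset.Ico (n - k) n, B (G l v)‖ ^ 2
        ≤ b ^ 2 * ∑ l ∈ Finset.Ico (n - k) n, (1 / 4 : ℝ) ^ l * ‖G l v‖ ^ 2 := by
      rw [pyth _ _ fun i _ j _ hne => hG2 i j v v hne, Finset.mul_sum]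
      refine Finset.sum_le_sum fun l _ => ?_
      have := pow_le_pow_left₀ (norm_nonneg _) (hG1 l v) 2
      rw [mul_pow, div_two_pow_sq] at this
      linarith
    have h3 : ‖B (v - ∑ l ∈ Finset.range n, G l v)‖ ^ 2 ≤ b ^ 2 * ((1 / 4) ^ n * ‖v‖ ^ 2) := by
      have := pow_le_pow_left₀ (norm_nonneg _) (hG4 n v) 2
      rw [mul_pow, div_two_pow_sq] at this
      linarith
    have h4 : ‖r k‖ ^ 2 ≤ 2 * (‖∑ l ∈ Finset.Ico (n - k) n, B (G l v)‖ ^ 2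
        + ‖B (v - ∑ l ∈ Finset.range n, G l v)‖ ^ 2) := by
      rw [h1]
      refine (pow_le_pow_left₀ (norm_nonneg _) (norm_add_le _ _) 2).trans ?_
      exact add_sq_le
    linarith
  have hsecond : ‖∑ k ∈ Finset.range n, A (E k (X (r k)))‖ ^ 2 ≤
      16 / 3 * (a * b / 2 ^ n * ‖X‖ * ‖v‖) ^ 2 := by
    rw [pyth _ _ fun i _ j _ hne => hE2 i j _ _ hne]
    have h1 : ∀ k ∈ Finset.range n, ‖A (E k (X (r k)))‖ ^ 2 ≤
        2 * a ^ 2 * b ^ 2 * ‖X‖ ^ 2 * ((1 / 4 : ℝ) ^ k *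
          (∑ l ∈ Finset.Ico (n - k) n, (1 / 4 : ℝ) ^ l * ‖G l v‖ ^ 2)
          + (1 / 4) ^ k * ((1 / 4) ^ n * ‖v‖ ^ 2)) := by
      intro k hk
      have h2 : ‖A (E k (X (r k)))‖ ≤ a / 2 ^ k * (‖X‖ * ‖r k‖) :=
        (hE1 k _).trans (by gcongr; exact (hEle k _).trans (X.le_opNorm _))
      have h3 := pow_le_pow_left₀ (norm_nonneg _) h2 2
      rw [mul_pow, mul_pow, div_two_pow_sq] at h3
      refine h3.trans ?_
      have h4 := mul_le_mul_of_nonneg_left (hrk k hk)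
        (show 0 ≤ a ^ 2 * (1 / 4) ^ k * ‖X‖ ^ 2 by positivity)
      linarith
    refine (Finset.sum_le_sum h1).trans ?_
    rw [← Finset.mul_sum, Finset.sum_add_distrib, ← Finset.sum_mul]
    have h2 := double_sum_bound n (fun l => ‖G l v‖ ^ 2) (fun l => by positivity)
    have h3 : 4 / 3 * (1 / 4 : ℝ) ^ n * ∑ l ∈ Finset.range n, ‖G l v‖ ^ 2
        ≤ 4 / 3 * (1 / 4) ^ n * ‖v‖ ^ 2 := by
      gcongr; exact hG3 n v
    have h4 : ∑ k ∈ Finset.range n, (1 / 4 : ℝ) ^ k ≤ 4 / 3 := by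
      have := geom_sum_Ico_le_of_lt_one (x := (1 / 4 : ℝ)) (m := 0) (n := n) (by norm_num) (by norm_num)
      rw [← Finset.range_eq_Ico] at this
      refine this.trans (by norm_num)
    have h5 := mul_le_mul_of_nonneg_right h4 (show 0 ≤ (1 / 4 : ℝ) ^ n * ‖v‖ ^ 2 by positivity)
    have h6 : (a * b / 2 ^ n * ‖X‖ * ‖v‖) ^ 2 = a ^ 2 * b ^ 2 * ‖X‖ ^ 2 * ((1 / 4) ^ n * ‖v‖ ^ 2) := by
      rw [mul_pow, mul_pow, div_two_pow_sq]; ring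
    rw [h6]
    have h7 := mul_le_mul_of_nonneg_left (add_le_add (h2.trans h3) h5)
      (show 0 ≤ 2 * a ^ 2 * b ^ 2 * ‖X‖ ^ 2 by positivity)
    refine h7.trans (le_of_eq ?_)
    ring
  set Q := a * b / 2 ^ n * ‖X‖ * ‖v‖ with hQ
  have hQ0 : 0 ≤ Q := by positivity
  have hsecond' : ‖∑ k ∈ Finset.range n, A (E k (X (r k)))‖ ≤ 3 * Q := by
    refine le_of_sq_le_sq ?_ (by positivity)
    nlinarith [sq_nonneg Q]
  have := norm_add_le (A (X (B v) - ∑ k ∈ Finset.range n, E k (X (B v))))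
    (∑ k ∈ Finset.range n, A (E k (X (r k))))
  have h8 : 4 * (a * b / 2 ^ n) * ‖X‖ * ‖v‖ = 4 * Q := by rw [hQ]; ring
  rw [h8]
  linarith

variable [CompleteSpace H]

lemma Mop_le_tensor {A B : H →L[ℂ] H} (hA : IsCompactOperator A) (hB : IsCompactOperator B)
    (htA : Filter.Tendsto (fun n => approxNum A (n + 1)) Filter.atTop (nhds 0))
    (htB : Filter.Tendsto (fun n => approxNum B (n + 1)) Filter.atTop (nhds 0)) (m : ℕ) :
    approxNum (Mop A B) (m + 1) ≤ 16 * tensorSeq (toC (sSeq A)) (toC (sSeq B)) m := by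
  set a := ‖A‖ + 1 with ha_def
  set b := ‖B‖ + 1 with hb_def
  have ha : 0 < a := by positivity
  have hb : 0 < b := by positivity
  obtain ⟨N, E, hN0, hNm, hN, hEr, hE1, hE2, hE3, hE4⟩ := blocks hA htA a (by simp [ha_def])
  obtain ⟨L, G, hL0, hLm, hL, hGr, hG1, hG2, hG3, hG4⟩ := blocks hB htB b (by simp [hb_def])
  -- the sets of index pairs
  set S : ℕ → Finset (ℕ × ℕ) := fun n => (Finset.range n).biUnion fun k =>
    (Finset.range (n - k)).biUnion fun l =>
      Finset.Ico (N k) (N (k + 1)) ×ˢ Finset.Ico (L l) (L (l + 1)) with hS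
  have hIco : ∀ (M : ℕ → ℕ), Monotone M → ∀ i j x, x ∈ Finset.Ico (M i) (M (i + 1)) →
      x ∈ Finset.Ico (M j) (M (j + 1)) → i = j := by
    intro M hM i j x h1 h2
    simp only [Finset.mem_Ico] at h1 h2
    by_contra hne
    rcases lt_or_gt_of_ne hne with h | h
    · have := hM (Nat.succ_le_of_lt h); simp only [Nat.succ_eq_add_one] at this; omega
    · have := hM (Nat.succ_le_of_lt h); simp only [Nat.succ_eq_add_one] at this; omega
  have hcard : ∀ n, (S n).card = ∑ k ∈ Finset.range n, ∑ l ∈ Finset.range (n - k),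
      (N (k + 1) - N k) * (L (l + 1) - L l) := by
    intro n
    rw [hS, Finset.card_biUnion]
    · refine Finset.sum_congr rfl fun k _ => ?_
      rw [Finset.card_biUnion]
      · simp
      · intro l _ l' _ hne
        simp only [Function.onFun]
        rw [Finset.disjoint_left]
        intro p h1 h2
        rw [Finset.mem_product] at h1 h2
        exact hne (hIco L hLm _ _ _ h1.2 h2.2)
    · intro k _ k' _ hne
      simp only [Function.onFun]
      rw [Finset.disjoint_left]
      intro p h1 h2
      simp only [Finset.mem_biUnion, Finset.mem_product] at h1 h2
      obtain ⟨l, _, h1⟩ := h1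
      obtain ⟨l', _, h2⟩ := h2
      exact hne (hIco N hNm _ _ _ h1.1 h2.1)
  have hupper : ∀ n, (S n).card ≤ m → approxNum (Mop A B) (m + 1) ≤ 4 * (a * b / 2 ^ n) := by
    intro n hn
    refine (an_le _ (∑ k ∈ Finset.range n, ∑ l ∈ Finset.range (n - k),
      Mop (A.comp (E k)) (B.comp (G l))) m ?_).trans
      (err_bound A B a b ha hb E G hE1 hE2 hE3 hE4 hG1 hG2 hG3 hG4 n)
    refine le_trans ?_ (show (((S n).card : ℕ) : Cardinal) ≤ m by exact_mod_cast hn)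
    rw [hcard]
    simp only [ContinuousLinearMap.toLinearMap_sum]
    refine (LinearMap.rank_finsetSum_le _ _).trans ?_
    push_cast [-Nat.cast_sub]
    refine Finset.sum_le_sum fun k _ => ?_
    refine (LinearMap.rank_finsetSum_le _ _).trans ?_
    refine Finset.sum_le_sum fun l _ => ?_
    have := Mop_norm_rank (A.comp (E k)) (B.comp (G l)) (N (k + 1) - N k) (L (l + 1) - L l)
      ((LinearMap.rank_comp_le_right (E k : H →ₗ[ℂ] H) (A : H →ₗ[ℂ] H)).trans (hEr k))
      ((LinearMap.rank_comp_le_right (G l : H →ₗ[ℂ] H) (B : H →ₗ[ℂ] H)).trans (hGr l))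
    exact_mod_cast this
  have hnorm : ∀ (T : H →L[ℂ] H) i, ‖toC (sSeq T) i‖ = approxNum T (i + 1) := fun T i => by
    simp [toC, sSeq, abs_of_nonneg (an_nonneg T (i + 1))]
  have hbound : ∀ p : ℕ × ℕ, ‖toC (sSeq A) p.1‖ * ‖toC (sSeq B) p.2‖ ≤ ‖A‖ * ‖B‖ := by
    intro p
    rw [hnorm, hnorm]
    exact mul_le_mul (an_le_norm _ _) (an_le_norm _ _) (an_nonneg _ _) (norm_nonneg _)
  have hlower : ∀ n, m < (S n).card → a * b / 2 ^ (n + 1) ≤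
      tensorSeq (toC (sSeq A)) (toC (sSeq B)) m := by
    intro n hn
    rw [tensorSeq_eq]
    refine gSum_lower hbound m (S n) hn fun p hp => ?_
    simp only [hS, Finset.mem_biUnion, Finset.mem_product, Finset.mem_range, Finset.mem_Ico] at hp
    obtain ⟨k, hk, l, hl, ⟨_, h1⟩, _, h2⟩ := hp
    have h3 := hN _ _ h1
    have h4 := hL _ _ h2
    rw [hnorm, hnorm]
    refine le_trans ?_ (mul_le_mul h3 h4 (by positivity) (an_nonneg _ _))
    rw [div_mul_div_comm, ← pow_add]
    exact div_le_div_of_nonneg_left (by positivity) (by positivity)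
      (pow_le_pow_right₀ (by norm_num) (by omega))
  have hnonneg : 0 ≤ tensorSeq (toC (sSeq A)) (toC (sSeq B)) m := by
    rw [tensorSeq_eq]
    obtain ⟨T, hT⟩ := Infinite.exists_subset_card_eq (ℕ × ℕ) (m + 1)
    exact gSum_lower hbound m T hT.ge fun p _ => by positivity
  by_cases hex : ∃ n, m < (S n).card
  · classical
    have h1 := hlower _ (Nat.find_spec hex)
    have hpos : Nat.find hex ≠ 0 := by
      intro h0
      have := Nat.find_spec hex
      rw [h0] at this
      simp [hS] at this
    obtain ⟨n, hn⟩ := Nat.exists_eq_succ_of_ne_zero hpos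
    have h2 := hupper n (not_lt.1 (Nat.find_min hex (by omega)))
    rw [hn] at h1
    have h3 : a * b / 2 ^ n = 4 * (a * b / 2 ^ (n.succ + 1)) := by
      rw [Nat.succ_eq_add_one, pow_add, pow_add]; field_simp; norm_num
    linarith
  · push Not at hex
    have h1 : approxNum (Mop A B) (m + 1) ≤ 0 := by
      have h2 : Filter.Tendsto (fun n : ℕ => 4 * (a * b / 2 ^ n)) Filter.atTop (nhds 0) := by
        have := (tendsto_pow_atTop_nhds_zero_of_lt_one (show (0 : ℝ) ≤ 1 / 2 by norm_num)
          (by norm_num)).const_mul (4 * (a * b))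
        rw [mul_zero] at this
        refine this.congr fun n => ?_
        rw [one_div, inv_pow]; ring
      exact ge_of_tendsto' h2 fun n => hupper n (hex n)
    linarith

end mult
end ElemOp

namespace ElemOp

/-! ### Hilbert numbers -/
section hilb
variable {X Y : Type u} [NormedAddCommGroup X] [NormedSpace ℂ X]
    [NormedAddCommGroup Y] [NormedSpace ℂ Y]

lemma an_comp {K H' : Type u} [NormedAddCommGroup K] [NormedSpace ℂ K] [NormedAddCommGroup H']
    [NormedSpace ℂ H'] (T : X →L[ℂ] Y) (B : K →L[ℂ] X) (A : Y →L[ℂ] H') (hB : ‖B‖ ≤ 1)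
    (hA : ‖A‖ ≤ 1) (n : ℕ) : approxNum ((A.comp T).comp B) (n + 1) ≤ approxNum T (n + 1) := by
  refine le_an T n _ fun F hF => ?_
  refine (an_le _ ((A.comp F).comp B) n ?_).trans ?_
  · refine le_trans ?_ hF
    refine (LinearMap.rank_comp_le_left (B : K →ₗ[ℂ] X) ((A.comp F : X →L[ℂ] H') : X →ₗ[ℂ] H')).trans ?_
    exact LinearMap.rank_comp_le_right (F : X →ₗ[ℂ] Y) (A : Y →ₗ[ℂ] H')
  · have : (A.comp T).comp B - (A.comp F).comp B = (A.comp (T - F)).comp B := by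
      ext x; simp
    rw [this]
    calc _ ≤ ‖A.comp (T - F)‖ * ‖B‖ := ContinuousLinearMap.opNorm_comp_le _ _
      _ ≤ (‖A‖ * ‖T - F‖) * ‖B‖ := by gcongr; exact ContinuousLinearMap.opNorm_comp_le _ _
      _ ≤ (1 * ‖T - F‖) * 1 := by gcongr
      _ = _ := by ring

lemma hil_le_an (T : X →L[ℂ] Y) (n : ℕ) : hilbertNum T (n + 1) ≤ approxNum T (n + 1) := by
  refine Real.sSup_le ?_ (an_nonneg _ _)
  rintro _ ⟨K, _, _, _, H', _, _, _, B, A, hB, hA, rfl⟩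
  exact an_comp T B A hB hA n

lemma hil_nonneg (T : X →L[ℂ] Y) (n : ℕ) : 0 ≤ hilbertNum T n := by
  refine Real.sSup_nonneg ?_
  rintro _ ⟨K, _, _, _, H', _, _, _, B, A, hB, hA, rfl⟩
  exact an_nonneg _ _

lemma le_hil {K H' : Type u} [NormedAddCommGroup K] [InnerProductSpace ℂ K] [CompleteSpace K]
    [NormedAddCommGroup H'] [InnerProductSpace ℂ H'] [CompleteSpace H']
    (T : X →L[ℂ] Y) (B : K →L[ℂ] X) (A : Y →L[ℂ] H') (hB : ‖B‖ ≤ 1)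
    (hA : ‖A‖ ≤ 1) (n : ℕ) : approxNum ((A.comp T).comp B) (n + 1) ≤ hilbertNum T (n + 1) := by
  refine le_csSup ⟨approxNum T (n + 1), ?_⟩ ⟨K, _, _, ‹_›, H', _, _, ‹_›, B, A, hB, hA, rfl⟩
  rintro _ ⟨K, _, _, _, H', _, _, _, B, A, hB, hA, rfl⟩
  exact an_comp T B A hB hA n

lemma hil_antitone (T : X →L[ℂ] Y) : Antitone (fun n => hilbertNum T (n + 1)) := by
  intro m n hmn
  refine Real.sSup_le ?_ (hil_nonneg _ _)
  rintro _ ⟨K, _, _, _, H', _, _, _, B, A, hB, hA, rfl⟩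
  exact (an_antitone _ hmn).trans (le_hil T B A hB hA m)

lemma le_hil_scaled {K H' : Type u} [NormedAddCommGroup K] [InnerProductSpace ℂ K] [CompleteSpace K]
    [NormedAddCommGroup H'] [InnerProductSpace ℂ H'] [CompleteSpace H']
    (T : X →L[ℂ] Y) (B : K →L[ℂ] X) (A : Y →L[ℂ] H') (n : ℕ) :
    approxNum ((A.comp T).comp B) (n + 1) ≤
      ((‖A‖ + 1) * (‖B‖ + 1)) * hilbertNum T (n + 1) := by
  have hc : ∀ {E F : Type u} [NormedAddCommGroup E] [NormedSpace ℂ E] [NormedAddCommGroup F]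
      [NormedSpace ℂ F] (S : E →L[ℂ] F), ‖(((‖S‖ + 1)⁻¹ : ℝ) : ℂ) • S‖ ≤ 1 := by
    intro E F _ _ _ _ S
    rw [norm_smul, Complex.norm_real, Real.norm_eq_abs, abs_of_nonneg (by positivity),
      inv_mul_le_iff₀ (by positivity)]
    linarith
  have h1 := le_hil T _ _ (hc B) (hc A) n
  have h2 : (A.comp T).comp B = (((‖A‖ + 1) * (‖B‖ + 1) : ℝ) : ℂ) •
      ((((((‖A‖ + 1)⁻¹ : ℝ) : ℂ) • A).comp T).comp ((((‖B‖ + 1)⁻¹ : ℝ) : ℂ) • B)) := by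
    ext x
    have hA0 : ((‖A‖ : ℂ) + 1) ≠ 0 := by
      have : (0 : ℝ) < ‖A‖ + 1 := by positivity
      exact_mod_cast this.ne'
    have hB0 : ((‖B‖ : ℂ) + 1) ≠ 0 := by
      have : (0 : ℝ) < ‖B‖ + 1 := by positivity
      exact_mod_cast this.ne'
    simp [smul_smul]
    rw [show ((‖A‖ : ℂ) + 1) * (‖B‖ + 1) * (((‖B‖ : ℂ) + 1)⁻¹ * ((‖A‖ : ℂ) + 1)⁻¹) = 1 by
      field_simp, one_smul]
  rw [h2]
  refine (an_smul _ _ n).trans ?_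
  rw [Complex.norm_real, Real.norm_eq_abs, abs_of_nonneg (by positivity)]
  gcongr

end hilb

/-! ### Conjugations -/
section conj
variable {H : Type*} [NormedAddCommGroup H] [InnerProductSpace ℂ H] [CompleteSpace H]

lemma exists_conj (H : Type*) [NormedAddCommGroup H] [InnerProductSpace ℂ H] [CompleteSpace H] :
    ∃ J : H →ₗ⋆[ℂ] H, (∀ x, ‖J x‖ = ‖x‖) ∧ ∀ x, J (J x) = x := by
  obtain ⟨w, b, hb⟩ := exists_hilbertBasis ℂ H
  let S : lp (fun _ : w => ℂ) 2 ≃ₗᵢ⋆[ℂ] lp (fun _ : w => ℂ) 2 := starₗᵢ ℂ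
  refine ⟨(b.repr.symm.toLinearEquiv.toLinearMap.comp S.toLinearEquiv.toLinearMap).comp
    b.repr.toLinearEquiv.toLinearMap, fun x => ?_, fun x => ?_⟩
  · simp
  · simp [S]

lemma conj_inner {J : H →ₗ⋆[ℂ] H} (hn : ∀ x, ‖J x‖ = ‖x‖) (x y : H) :
    inner ℂ (J x) (J y) = inner ℂ y x := by
  have hI : ∀ z : H, J (Complex.I • z) = -(Complex.I • J z) := fun z => by simp
  rw [← inner_conj_symm y x, inner_eq_sum_norm_sq_div_four (𝕜 := ℂ) x y,
    inner_eq_sum_norm_sq_div_four (𝕜 := ℂ) (J x) (J y)]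
  have h1 : ‖J x + J y‖ = ‖x + y‖ := by rw [← map_add, hn]
  have h2 : ‖J x - J y‖ = ‖x - y‖ := by rw [← map_sub, hn]
  have h3 : ‖J x - (RCLike.I : ℂ) • J y‖ = ‖x + (RCLike.I : ℂ) • y‖ := by
    rw [← hn (x + _), map_add]; congr 1
    rw [show (RCLike.I : ℂ) = Complex.I from rfl, hI]; abel
  have h4 : ‖J x + (RCLike.I : ℂ) • J y‖ = ‖x - (RCLike.I : ℂ) • y‖ := by
    rw [← hn (x - _), map_sub]; congr 1
    rw [show (RCLike.I : ℂ) = Complex.I from rfl, hI]; abel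
  rw [h1, h2, h3, h4]
  have h5 : (starRingEnd ℂ) 4 = 4 := map_ofNat _ 4
  simp [h5]
  ring

lemma an_conj {J : H →ₗ⋆[ℂ] H} (hn : ∀ x, ‖J x‖ = ‖x‖) (hJ : ∀ x, J (J x) = x)
    (T R : H →L[ℂ] H) (hR : ∀ x, R x = J (ContinuousLinearMap.adjoint T (J x))) (n : ℕ) :
    approxNum T (n + 1) ≤ approxNum R (n + 1) := by
  refine le_an R n _ fun F hF => ?_
  let G : H →L[ℂ] H := LinearMap.mkContinuous
    { toFun := fun x => J (F (J x))
      map_add' := fun x y => by simp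
      map_smul' := fun c x => by simp } ‖F‖ (fun x => by
        show ‖J (F (J x))‖ ≤ _
        rw [hn]; exact (F.le_opNorm _).trans (by rw [hn]))
  have hG : ∀ x, G x = J (F (J x)) := fun x => rfl
  refine (an_le T (ContinuousLinearMap.adjoint G) n ?_).trans ?_
  · have hfd : FiniteDimensional ℂ (LinearMap.range (F : H →ₗ[ℂ] H)) :=
      Module.rank_lt_aleph0_iff.1 (lt_of_le_of_lt hF (Cardinal.natCast_lt_aleph0))
    let e := stdOrthonormalBasis ℂ (LinearMap.range (F : H →ₗ[ℂ] H))
    have hFe : ∀ y, F y = ∑ i, inner ℂ ((e i : LinearMap.range (F : H →ₗ[ℂ] H)) : H) (F y) • (e i : H) := by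
      intro y
      have h1 := e.sum_repr' ⟨F y, ⟨y, rfl⟩⟩
      have h2 := congrArg Subtype.val h1
      rw [AddSubmonoidClass.coe_finsetSum] at h2
      exact h2.symm
    have hsub : LinearMap.range ((ContinuousLinearMap.adjoint G : H →L[ℂ] H) : H →ₗ[ℂ] H) ≤
        Submodule.span ℂ (Set.range fun i => J (ContinuousLinearMap.adjoint F (e i : H))) := by
      rintro _ ⟨z, rfl⟩
      have : ContinuousLinearMap.adjoint G z =
          ∑ i, inner ℂ (J (e i : H)) z • J (ContinuousLinearMap.adjoint F (e i : H)) := by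
        refine ext_inner_right ℂ fun x => ?_
        rw [ContinuousLinearMap.adjoint_inner_left, hG, hFe, map_sum, inner_sum, sum_inner]
        refine Finset.sum_congr rfl fun i _ => ?_
        rw [LinearMap.map_smulₛₗ, inner_smul_right, inner_smul_left, inner_conj_symm, inner_conj_symm,
          ← ContinuousLinearMap.adjoint_inner_right]
        have := conj_inner hn (ContinuousLinearMap.adjoint F (e i : H)) (J x)
        rw [hJ] at this
        rw [this, mul_comm]
      show ContinuousLinearMap.adjoint G z ∈ _
      rw [this]
      exact Submodule.sum_mem _ fun i _ => Submodule.smul_mem _ _ (Submodule.subset_span ⟨i, rfl⟩)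
    refine (Submodule.rank_mono hsub).trans ((rank_span_le _).trans ?_)
    refine (Cardinal.mk_range_le_lift (f := fun i => J (ContinuousLinearMap.adjoint F (e i : H))) |> fun h => ?_)
    have h2 := Module.finrank_le_of_rank_le hF
    have h3 : Cardinal.lift.{0} (Cardinal.mk (Set.range fun i => J (ContinuousLinearMap.adjoint F (e i : H)))) ≤ (Module.finrank ℂ (LinearMap.range (F : H →ₗ[ℂ] H)) : Cardinal) := by
      simpa using h
    rw [Cardinal.lift_uzero] at h3
    exact h3.trans (by exact_mod_cast h2)
  · have h1 : T - ContinuousLinearMap.adjoint G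
        = ContinuousLinearMap.adjoint (ContinuousLinearMap.adjoint T - G) := by
      rw [map_sub, ContinuousLinearMap.adjoint_adjoint]
    rw [h1, LinearIsometryEquiv.norm_map]
    refine ContinuousLinearMap.opNorm_le_bound _ (norm_nonneg _) fun x => ?_
    have h2 : (ContinuousLinearMap.adjoint T - G) x = J ((R - F) (J x)) := by
      simp only [sub_apply, hG, hR, map_sub, hJ]
    rw [h2, hn]
    exact ((R - F).le_opNorm _).trans (by rw [hn])

end conj

end ElemOp

namespace ElemOp

section final
variable {H : Type u} [NormedAddCommGroup H] [InnerProductSpace ℂ H] [CompleteSpace H]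

lemma exists_minimal (Φ : (H →L[ℂ] H) →L[ℂ] (H →L[ℂ] H))
    (helem : ∃ (m : ℕ) (A B : Fin m → H →L[ℂ] H), Φ = ∑ i, Mop (A i) (B i)) :
    ∃ (m : ℕ) (A B : Fin m → H →L[ℂ] H), Φ = ∑ i, Mop (A i) (B i) ∧
      LinearIndependent ℂ A ∧ LinearIndependent ℂ B := by
  classical
  obtain ⟨A, B, hΦ⟩ := Nat.find_spec helem
  have hmin := fun k (hk : k < Nat.find helem) => Nat.find_min helem hk
  generalize Nat.find helem = m at A B hΦ hmin
  refine ⟨m, A, B, hΦ, ?_, ?_⟩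
  · by_contra hli
    obtain ⟨g, hg, i0, hi0⟩ := Fintype.not_linearIndependent_iff.1 hli
    obtain ⟨m, rfl⟩ : ∃ k, m = k + 1 := ⟨m - 1, by have := i0.2; omega⟩
    refine hmin m (by omega) ⟨fun i => A (i0.succAbove i),
      fun i => B (i0.succAbove i) - (g (i0.succAbove i) / g i0) • B i0, ?_⟩
    have key : Φ = ∑ i, Mop (A i) (B i - (g i / g i0) • B i0) := by
      rw [hΦ]
      have h1 : ∀ i, Mop (A i) (B i - (g i / g i0) • B i0)
          = Mop (A i) (B i) - (g i0)⁻¹ • Mop (g i • A i) (B i0) := by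
        intro i
        ext X x
        simp [Mop, div_eq_inv_mul, smul_smul]
      have h2 : ∑ i, Mop (g i • A i) (B i0) = Mop (∑ i, g i • A i) (B i0) := by
        ext X x
        simp [Mop]
      simp only [h1, Finset.sum_sub_distrib, ← Finset.smul_sum]
      rw [h2, hg]
      ext X x
      simp [Mop]
    rw [key, Fin.sum_univ_succAbove _ i0]
    rw [div_self hi0, one_smul, sub_self]
    ext X x
    simp [Mop]
  · by_contra hli
    obtain ⟨g, hg, i0, hi0⟩ := Fintype.not_linearIndependent_iff.1 hli
    obtain ⟨m, rfl⟩ : ∃ k, m = k + 1 := ⟨m - 1, by have := i0.2; omega⟩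
    refine hmin m (by omega) ⟨fun i => A (i0.succAbove i) - (g (i0.succAbove i) / g i0) • A i0,
      fun i => B (i0.succAbove i), ?_⟩
    have key : Φ = ∑ i, Mop (A i - (g i / g i0) • A i0) (B i) := by
      rw [hΦ]
      have h1 : ∀ i, Mop (A i - (g i / g i0) • A i0) (B i)
          = Mop (A i) (B i) - (g i0)⁻¹ • Mop (A i0) (g i • B i) := by
        intro i
        ext X x
        simp [Mop, div_eq_inv_mul, smul_smul]
      have h2 : ∑ i, Mop (A i0) (g i • B i) = Mop (A i0) (∑ i, g i • B i) := by
        ext X x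
        simp [Mop]
      simp only [h1, Finset.sum_sub_distrib, ← Finset.smul_sum]
      rw [h2, hg]
      ext X x
      simp [Mop]
    rw [key, Fin.sum_univ_succAbove _ i0]
    rw [div_self hi0, one_smul, sub_self]
    ext X x
    simp [Mop]

lemma span_coeff {m : ℕ} (C : Fin m → H →L[ℂ] H) (hC : LinearIndependent ℂ C) :
    Submodule.span ℂ (Set.range fun p : H × H => fun i => inner ℂ p.1 (C i p.2)) = ⊤ := by
  by_contra hne
  obtain ⟨f, hf0, hf⟩ := Submodule.exists_le_ker_of_lt_top _ (lt_top_iff_ne_top.2 hne)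
  apply hf0
  have h1 : ∀ c : Fin m → ℂ, f c = ∑ i, c i * f (fun j => if i = j then 1 else 0) := by
    intro c
    rw [LinearMap.pi_apply_eq_sum_univ f c]
    simp
  have h2 : ∑ i, f (fun j => if i = j then 1 else 0) • C i = 0 := by
    ext w
    refine ext_inner_left ℂ fun v => ?_
    have h3 : (fun i => inner ℂ v (C i w)) ∈ LinearMap.ker f :=
      hf (Submodule.subset_span ⟨(v, w), rfl⟩)
    rw [LinearMap.mem_ker, h1] at h3
    simp only [sum_apply, smul_apply, inner_sum,
      inner_smul_right, zero_apply, inner_zero_right]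
    refine Eq.trans ?_ h3
    exact Finset.sum_congr rfl fun i _ => mul_comm _ _
  have h3 := Fintype.linearIndependent_iff.1 hC _ h2
  refine LinearMap.ext fun c => ?_
  rw [h1 c, LinearMap.zero_apply]
  exact Finset.sum_eq_zero fun i _ => by rw [h3 i, mul_zero]

lemma all_mem {m : ℕ} (C D : Fin m → H →L[ℂ] H) (hC : LinearIndependent ℂ C)
    (S : Submodule ℂ (H →L[ℂ] H)) (h : ∀ v w : H, ∑ i, inner ℂ v (C i w) • D i ∈ S) (j : Fin m) :
    D j ∈ S := by
  classical
  let L : (Fin m → ℂ) →ₗ[ℂ] (H →L[ℂ] H) := Fintype.linearCombination ℂ D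
  have h1 : Submodule.span ℂ (Set.range fun p : H × H => fun i => inner ℂ p.1 (C i p.2))
      ≤ S.comap L := by
    rw [Submodule.span_le]
    rintro _ ⟨p, rfl⟩
    simpa [L, Fintype.linearCombination_apply] using h p.1 p.2
  rw [span_coeff C hC] at h1
  have h2 := h1 (Submodule.mem_top (x := Pi.single j 1))
  simpa [L, Fintype.linearCombination_apply_single] using h2

variable {I : Set (ℕ → ℂ)} {Φ : (H →L[ℂ] H) →L[ℂ] (H →L[ℂ] H)}

lemma mem_of_le_hil (hI : IsCalkinSpace I) (h : toC (fun n => hilbertNum Φ (n + 1)) ∈ I)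
    (T : H →L[ℂ] H) (C : ℝ) (hT : ∀ n, approxNum T (n + 1) ≤ C * hilbertNum Φ (n + 1)) :
    T ∈ sIdeal H H hI := by
  rw [mem_sIdeal]
  refine calkin_dom hI h (an_antitone T) (fun n => an_nonneg _ _) C fun n => ?_
  have : ‖toC (fun n => hilbertNum Φ (n + 1)) n‖ = hilbertNum Φ (n + 1) := by
    simp [toC, abs_of_nonneg (hil_nonneg Φ (n + 1))]
  rw [this]
  exact hT n

lemma A_side (hI : IsCalkinSpace I) (h : toC (fun n => hilbertNum Φ (n + 1)) ∈ I)
    {m : ℕ} (A B : Fin m → H →L[ℂ] H) (hΦ : Φ = ∑ i, Mop (A i) (B i)) (v w : H) :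
    ∑ i, inner ℂ v (B i w) • A i ∈ sIdeal H H hI := by
  let Bm : H →L[ℂ] (H →L[ℂ] H) := ContinuousLinearMap.smulRightL ℂ H H (innerSL ℂ v)
  let Am : (H →L[ℂ] H) →L[ℂ] H := ContinuousLinearMap.apply ℂ H w
  have h1 : (Am.comp Φ).comp Bm = ∑ i, inner ℂ v (B i w) • A i := by
    ext x
    simp [Am, Bm, hΦ, Mop]
  rw [← h1]
  exact mem_of_le_hil hI h _ _ fun n => le_hil_scaled Φ Bm Am n

lemma B_side (hI : IsCalkinSpace I) (h : toC (fun n => hilbertNum Φ (n + 1)) ∈ I)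
    {m : ℕ} (A B : Fin m → H →L[ℂ] H) (hΦ : Φ = ∑ i, Mop (A i) (B i)) (a u : H) :
    ∑ i, inner ℂ a (A i u) • B i ∈ sIdeal H H hI := by
  obtain ⟨J, hn, hJ⟩ := exists_conj H
  let Bm : H →L[ℂ] (H →L[ℂ] H) := LinearMap.mkContinuous
    { toFun := fun x => (innerSL ℂ (J x)).smulRight u
      map_add' := fun x y => by ext z; simp [inner_add_left, add_smul]
      map_smul' := fun c x => by ext z; simp [inner_smul_left, smul_smul] } ‖u‖ (fun x => by
        show ‖(innerSL ℂ (J x)).smulRight u‖ ≤ _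
        rw [ContinuousLinearMap.norm_smulRight_apply, innerSL_apply_norm, hn, mul_comm])
  let Am : (H →L[ℂ] H) →L[ℂ] H := LinearMap.mkContinuous
    { toFun := fun Y => J (ContinuousLinearMap.adjoint Y a)
      map_add' := fun x y => by simp
      map_smul' := fun c x => by
        rw [LinearIsometryEquiv.map_smulₛₗ]; simp } ‖a‖ (fun Y => by
        show ‖J (ContinuousLinearMap.adjoint Y a)‖ ≤ _
        rw [hn, mul_comm]
        refine (ContinuousLinearMap.le_opNorm _ _).trans ?_
        rw [LinearIsometryEquiv.norm_map])
  have hB : ∀ x z, Bm x z = (inner ℂ (J x) z : ℂ) • u := fun x z => rfl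
  have hA : ∀ Y, Am Y = J (ContinuousLinearMap.adjoint Y a) := fun Y => rfl
  refine mem_of_le_hil hI h _ _ fun n => le_trans (an_conj hn hJ _ ((Am.comp Φ).comp Bm) ?_ n)
    (le_hil_scaled Φ Bm Am n)
  intro x
  show Am (Φ (Bm x)) = _
  rw [hA]
  congr 1
  refine ext_inner_right ℂ fun z => ?_
  rw [ContinuousLinearMap.adjoint_inner_left, ContinuousLinearMap.adjoint_inner_left, hΦ]
  simp only [sum_apply, smul_apply, inner_sum,
      inner_smul_right]
  refine Finset.sum_congr rfl fun i _ => ?_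
  have : (Mop (A i) (B i)) (Bm x) z = A i (Bm x (B i z)) := rfl
  rw [this, hB, map_smul, inner_smul_right, mul_comm]

lemma Mop_mem (hI : IsStableCalkin I) (A B : H →L[ℂ] H) (hA : IsCompactOperator A)
    (hB : IsCompactOperator B) (hA' : toC (sSeq A) ∈ I) (hB' : toC (sSeq B) ∈ I) :
    Mop A B ∈ sIdeal (H →L[ℂ] H) (H →L[ℂ] H) hI.1 := by
  rw [mem_sIdeal]
  have hmem : toC (tensorSeq (toC (sSeq A)) (toC (sSeq B))) ∈ I := by
    rw [← hI.2]
    intro K hK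
    exact hK.2 _ hA' _ hB'
  refine calkin_dom hI.1 hmem (an_antitone _) (fun n => an_nonneg _ _) 16 fun n => ?_
  refine (Mop_le_tensor hA hB (an_tendsto_of_mem hI.1 A hA') (an_tendsto_of_mem hI.1 B hB') n).trans ?_
  have : tensorSeq (toC (sSeq A)) (toC (sSeq B)) n ≤
      ‖toC (tensorSeq (toC (sSeq A)) (toC (sSeq B))) n‖ := by
    simp only [toC, Complex.norm_real]
    exact Real.le_norm_self _
  linarith

end final

end ElemOp

open ElemOp

/-- Let `H` be a separable infinite-dimensional Hilbert space, `𝔦` a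
stable Calkin space and `Φ` an elementary operator on `B(H)`.  Then the following are
equivalent: (i) `(hₙ(Φ))ₙ ∈ 𝔦`; (ii) `(aₙ(Φ))ₙ ∈ 𝔦`; (iii) `Φ = Σᵢ M_{Aᵢ,Bᵢ}` for some
compact operators `Aᵢ, Bᵢ` with `s(Aᵢ), s(Bᵢ) ∈ 𝔦`. -/
theorem elementary_sNumbers_iff {H : Type u} [NormedAddCommGroup H]
    [InnerProductSpace ℂ H] [CompleteSpace H] [TopologicalSpace.SeparableSpace H]
    (hinf : ¬ FiniteDimensional ℂ H)
    (I : Set (ℕ → ℂ)) (hI : IsStableCalkin I)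
    (Φ : (H →L[ℂ] H) →L[ℂ] (H →L[ℂ] H))
    (helem : ∃ (m : ℕ) (A B : Fin m → H →L[ℂ] H), Φ = ∑ i, Mop (A i) (B i)) :
    ((toC (fun n => hilbertNum Φ (n + 1)) ∈ I) ↔
        (toC (fun n => approxNum Φ (n + 1)) ∈ I)) ∧
    ((toC (fun n => approxNum Φ (n + 1)) ∈ I) ↔
        ∃ (m : ℕ) (A B : Fin m → H →L[ℂ] H),
          Φ = (∑ i, Mop (A i) (B i)) ∧
          ∀ i, IsCompactOperator ⇑(A i) ∧ IsCompactOperator ⇑(B i) ∧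
            toC (sSeq (A i)) ∈ I ∧ toC (sSeq (B i)) ∈ I) := by
  have h21 : (toC (fun n => approxNum Φ (n + 1)) ∈ I) →
      (toC (fun n => hilbertNum Φ (n + 1)) ∈ I) := by
    intro h
    refine calkin_dom hI.1 h (hil_antitone Φ) (fun n => hil_nonneg _ _) 1 fun n => ?_
    rw [one_mul]
    refine (hil_le_an Φ n).trans ?_
    simp only [toC, Complex.norm_real]
    exact Real.le_norm_self _
  have h13 : (toC (fun n => hilbertNum Φ (n + 1)) ∈ I) →
      ∃ (m : ℕ) (A B : Fin m → H →L[ℂ] H),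
          Φ = (∑ i, Mop (A i) (B i)) ∧
          ∀ i, IsCompactOperator ⇑(A i) ∧ IsCompactOperator ⇑(B i) ∧
            toC (sSeq (A i)) ∈ I ∧ toC (sSeq (B i)) ∈ I := by
    intro h
    obtain ⟨m, A, B, hΦ, hA, hB⟩ := exists_minimal Φ helem
    refine ⟨m, A, B, hΦ, fun i => ?_⟩
    have hAi := all_mem B A hB _ (A_side hI.1 h A B hΦ) i
    have hBi := all_mem A B hA _ (B_side hI.1 h A B hΦ) i
    exact ⟨compact_of_tendsto _ (an_tendsto_of_mem hI.1 _ hAi),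
      compact_of_tendsto _ (an_tendsto_of_mem hI.1 _ hBi), hAi, hBi⟩
  have h32 : (∃ (m : ℕ) (A B : Fin m → H →L[ℂ] H),
          Φ = (∑ i, Mop (A i) (B i)) ∧
          ∀ i, IsCompactOperator ⇑(A i) ∧ IsCompactOperator ⇑(B i) ∧
            toC (sSeq (A i)) ∈ I ∧ toC (sSeq (B i)) ∈ I) →
      (toC (fun n => approxNum Φ (n + 1)) ∈ I) := by
    rintro ⟨m, A, B, hΦ, h⟩
    rw [← mem_sIdeal hI.1, hΦ]
    exact Submodule.sum_mem _ fun i _ => Mop_mem hI _ _ (h i).1 (h i).2.1 (h i).2.2.1 (h i).2.2.2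
  exact ⟨⟨fun h => h32 (h13 h), h21⟩, ⟨fun h => h13 (h21 h), h32⟩⟩
end
end
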